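/- There exists a finitely presented group that is two-sided orderable and has insoluble word problem. -/

import Mathlib

/-- Evaluation of a word (a list of generator indices with exponent signs) at a family
of elements of a group. -/
def wordEval {k : ℕ} {G : Type*} [Group G] (gen : Fin k → G)
    (w : List (Fin k × Bool)) : G :=
  (w.map fun p => if p.2 then gen p.1 else (gen p.1)⁻¹).prod

namespace OrdWP

/-- A group is bi-orderable: it has a conjugation invariant positive cone. -/
structure IsCone {G : Type*} [Group G] (P : Set G) : Prop where
  one : (1 : G) ∉ P
  mul : ∀ a ∈ P, ∀ b ∈ P, a * b ∈ P
  conj : ∀ a ∈ P, ∀ g : G, g * a * g⁻¹ ∈ P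
  total : ∀ a : G, a ≠ 1 → a ∈ P ∨ a⁻¹ ∈ P

def BiOrd (G : Type*) [Group G] : Prop := ∃ P : Set G, IsCone P

theorem IsCone.lt {G : Type*} [Group G] {P : Set G} (h : IsCone P) :
    ∃ lt : G → G → Prop, IsStrictTotalOrder _ lt ∧
      ∀ f g h x, lt f g → lt (h * f * x) (h * g * x) := by
  refine ⟨fun a b => a⁻¹ * b ∈ P, ?_, ?_⟩
  · refine { trichotomous := ?_, irrefl := ?_, trans := ?_ }
    · intro a b h1 h2
      by_contra hne
      rcases h.total (a⁻¹ * b) (by rwa [Ne, inv_mul_eq_one]) with h3 | h3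
      · exact h1 h3
      · exact h2 (by simpa using h3)
    · intro a ha
      exact h.one (by simpa using ha)
    · intro a b c h1 h2
      have := h.mul _ h1 _ h2
      simpa [mul_assoc] using this
  · intro f g k x hfg
    have := h.conj _ hfg x⁻¹
    simpa [mul_assoc] using this

theorem BiOrd.of_injective {G H : Type*} [Group G] [Group H] (f : G →* H)
    (hf : Function.Injective f) (h : BiOrd H) : BiOrd G := by
  obtain ⟨P, hP⟩ := h
  refine ⟨f ⁻¹' P, ?_, ?_, ?_, ?_⟩
  · simpa using hP.one
  · intro a ha b hb
    simpa using hP.mul _ ha _ hb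
  · intro a ha g
    simpa using hP.conj _ ha (f g)
  · intro a ha
    have := hP.total (f a) (by rwa [Ne, map_eq_one_iff f hf])
    simpa using this

theorem BiOrd.prod {G H : Type*} [Group G] [Group H] (hG : BiOrd G) (hH : BiOrd H) :
    BiOrd (G × H) := by
  obtain ⟨P, hP⟩ := hG
  obtain ⟨Q, hQ⟩ := hH
  refine ⟨{x | x.1 ∈ P ∨ (x.1 = 1 ∧ x.2 ∈ Q)}, ?_, ?_, ?_, ?_⟩
  · simp [hP.one, hQ.one]
  · rintro ⟨a, b⟩ h1 ⟨c, d⟩ h2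
    simp only [Set.mem_ofPred_eq, Prod.mk_mul_mk] at *
    rcases h1 with h1 | ⟨rfl, h1⟩ <;> rcases h2 with h2 | ⟨rfl, h2⟩
    · exact Or.inl (hP.mul _ h1 _ h2)
    · left; simpa using h1
    · left; simpa using h2
    · right; exact ⟨by simp, hQ.mul _ h1 _ h2⟩
  · rintro ⟨a, b⟩ h1 ⟨c, d⟩
    simp only [Set.mem_ofPred_eq, Prod.mk_mul_mk, Prod.inv_mk] at *
    rcases h1 with h1 | ⟨rfl, h1⟩
    · exact Or.inl (hP.conj _ h1 _)
    · right; exact ⟨by simp, hQ.conj _ h1 _⟩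
  · rintro ⟨a, b⟩ h1
    simp only [Set.mem_ofPred_eq, Prod.inv_mk]
    by_cases ha : a = 1
    · subst ha
      have hb : b ≠ 1 := by rintro rfl; exact h1 rfl
      rcases hQ.total b hb with h | h <;> simp [h]
    · rcases hP.total a ha with h | h <;> simp [h]

section Pow
open PowerSeries
variable {S : Type*} [Ring S]

structure IsPos (pos : S → Prop) : Prop where
  zero : ¬ pos 0
  add : ∀ a b, pos a → pos b → pos (a + b)
  total : ∀ a, a ≠ 0 → pos a ∨ pos (-a)

def PPos (pos : S → Prop) (F : PowerSeries S) : Prop :=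
  ∃ d, (∀ j < d, coeff j F = 0) ∧ pos (coeff d F)

theorem PPos.zero {pos : S → Prop} (h : IsPos pos) : ¬ PPos pos (0 : PowerSeries S) := by
  rintro ⟨d, -, h1⟩
  exact h.zero (by simpa using h1)

theorem PPos.add {pos : S → Prop} (h : IsPos pos) {F G : PowerSeries S}
    (hF : PPos pos F) (hG : PPos pos G) : PPos pos (F + G) := by
  obtain ⟨d, h1, h2⟩ := hF
  obtain ⟨e, h3, h4⟩ := hG
  rcases lt_trichotomy d e with hd | rfl | hd
  · refine ⟨d, fun j hj => ?_, ?_⟩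
    · simp [h1 j hj, h3 j (hj.trans hd)]
    · simpa [h3 d hd] using h2
  · refine ⟨d, fun j hj => ?_, ?_⟩
    · simp [h1 j hj, h3 j hj]
    · simpa using h.add _ _ h2 h4
  · refine ⟨e, fun j hj => ?_, ?_⟩
    · simp [h3 j hj, h1 j (hj.trans hd)]
    · simpa [h1 e hd] using h4

theorem PPos.total {pos : S → Prop} (h : IsPos pos) {F : PowerSeries S} (hF : F ≠ 0) :
    PPos pos F ∨ PPos pos (-F) := by
  classical
  have hex : ∃ n, coeff n F ≠ 0 := by
    by_contra! hh
    exact hF (PowerSeries.ext (by simpa using hh))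
  have hlt : ∀ j < Nat.find hex, coeff j F = 0 := fun j hj => by
    simpa using Nat.find_min hex hj
  rcases h.total _ (Nat.find_spec hex) with h1 | h1
  · exact Or.inl ⟨_, hlt, h1⟩
  · exact Or.inr ⟨_, fun j hj => by simp [hlt j hj], by simpa using h1⟩

theorem coeff_left {H F : PowerSeries S} (hH : coeff 0 H = 1) {d : ℕ}
    (hF : ∀ j < d, coeff j F = 0) : ∀ j ≤ d, coeff j (H * F) = coeff j F := by
  intro j hj
  rw [coeff_mul, Finset.sum_eq_single (0, j)]
  · simp only [hH, one_mul]
  · rintro ⟨a, b⟩ hab hne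
    replace hab : a + b = j := Finset.HasAntidiagonal.mem_antidiagonal.mp hab
    have : b < d := by
      have : a ≠ 0 := by rintro rfl; apply hne; simp at hab; simp [hab]
      omega
    simp [hF b this]
  · simp

theorem coeff_right {H F : PowerSeries S} (hH : coeff 0 H = 1) {d : ℕ}
    (hF : ∀ j < d, coeff j F = 0) : ∀ j ≤ d, coeff j (F * H) = coeff j F := by
  intro j hj
  rw [coeff_mul, Finset.sum_eq_single (j, 0)]
  · simp only [hH, mul_one]
  · rintro ⟨a, b⟩ hab hne
    replace hab : a + b = j := Finset.HasAntidiagonal.mem_antidiagonal.mp hab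
    have : a < d := by
      have : b ≠ 0 := by rintro rfl; apply hne; simp at hab; simp [hab]
      omega
    simp [hF a this]
  · simp

theorem PPos.left {pos : S → Prop} {H F : PowerSeries S} (hH : coeff 0 H = 1)
    (hF : PPos pos F) : PPos pos (H * F) := by
  obtain ⟨d, h1, h2⟩ := hF
  refine ⟨d, fun j hj => ?_, ?_⟩
  · rw [coeff_left hH h1 j hj.le, h1 j hj]
  · rwa [coeff_left hH h1 d le_rfl]

theorem PPos.right {pos : S → Prop} {H F : PowerSeries S} (hH : coeff 0 H = 1)
    (hF : PPos pos F) : PPos pos (F * H) := by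
  obtain ⟨d, h1, h2⟩ := hF
  refine ⟨d, fun j hj => ?_, ?_⟩
  · rw [coeff_right hH h1 j hj.le, h1 j hj]
  · rwa [coeff_right hH h1 d le_rfl]

/-- Pulling back the order along a homomorphism to the one-units. -/
theorem cone_of_hom {K : Type*} [Group K] {pos : S → Prop} (h : IsPos pos)
    (ρ : K →* (PowerSeries S)ˣ) (h0 : ∀ g, coeff 0 (ρ g : PowerSeries S) = 1)
    (hinj : ∀ g, (ρ g : PowerSeries S) = 1 → g = 1) :
    IsCone {g : K | PPos pos ((ρ g : PowerSeries S) - 1)} := by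
  refine ⟨?_, ?_, ?_, ?_⟩
  · simpa using PPos.zero h
  · intro a ha b hb
    simp only [Set.mem_ofPred_eq] at *
    have : (ρ (a * b) : PowerSeries S) - 1 = (ρ a - 1 : PowerSeries S) * ρ b + (ρ b - 1) := by
      simp [sub_mul]
    rw [this]
    exact (ha.right (h0 b)).add h hb
  · intro a ha g
    simp only [Set.mem_ofPred_eq] at *
    have : (ρ (g * a * g⁻¹) : PowerSeries S) - 1 = ρ g * (ρ a - 1 : PowerSeries S) * ρ g⁻¹ := by
      have h2 : (ρ g : PowerSeries S) * ρ g⁻¹ = 1 := by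
        rw [← Units.val_mul, ← map_mul]; simp
      simp only [mul_sub, sub_mul, mul_one, h2, map_mul, Units.val_mul]
    rw [this]
    exact (ha.left (h0 g)).right (h0 _)
  · intro a ha
    simp only [Set.mem_ofPred_eq]
    have hne : (ρ a - 1 : PowerSeries S) ≠ 0 := fun hh => ha (hinj a (sub_eq_zero.mp hh))
    rcases PPos.total h hne with h1 | h1
    · exact Or.inl h1
    · right
      have : (ρ a⁻¹ : PowerSeries S) - 1 = ρ a⁻¹ * -(ρ a - 1 : PowerSeries S) := by
        have h2 : (ρ a⁻¹ : PowerSeries S) * ρ a = 1 := by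
          rw [← Units.val_mul, ← map_mul]; simp
        simp only [mul_neg, mul_sub, h2, mul_one, neg_sub]
      rw [this]
      exact h1.left (h0 _)

end Pow
end OrdWP

namespace OrdWP

section Magnus
variable {X : Type*}

/-- Combinatorial invariant used to show that the Magnus map is injective. -/
def MStep (x : X) (b : Bool) (F F' : List X → ℤ) : Prop :=
  ∀ w : List X, w.head? ≠ some x →
    F' w = F w ∧ F' (x :: w) = F (x :: w) + (if b then 1 else -1) * F w

def Alt (w : List X) : Prop := w.IsChain (· ≠ ·)

def MInv (x : X) (b : Bool) (F : List X → ℤ) : Prop :=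
  ∃ (v : List X) (c e : ℤ), Alt v ∧ v.head? ≠ some x ∧ c ≠ 0 ∧ F v = c ∧ F (x :: v) = e * c ∧
    (if b then 0 < e else e < 0) ∧
    (∀ w, Alt w → w.head? ≠ some x → v.length < w.length → F w = 0) ∧
    (∀ w, Alt (x :: w) → v.length < w.length → F (x :: w) = 0)

theorem alt_cons {x : X} {w : List X} : Alt (x :: w) ↔ w.head? ≠ some x ∧ Alt w := by
  unfold Alt
  cases w with
  | nil => simp
  | cons y w => simp [List.isChain_cons_cons, eq_comm]

theorem MInv.base {x : X} {b : Bool} {F F' : List X → ℤ} (h : MStep x b F F')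
    (h0 : F [] = 1) (h1 : ∀ w, w ≠ [] → F w = 0) : MInv x b F' := by
  refine ⟨[], 1, if b then 1 else -1, by simp [Alt], by simp, by simp, ?_, ?_, ?_, ?_, ?_⟩
  · rw [(h [] (by simp)).1, h0]
  · rw [(h [] (by simp)).2, h0, h1 _ (by simp)]; simp
  · cases b <;> simp
  · intro w _ hw hl
    rw [(h w hw).1, h1]
    rintro rfl; simp at hl
  · intro w hw hl
    rw [(h w (alt_cons.mp hw).1).2, h1 w, h1 _ (by simp)]
    · simp
    · rintro rfl; simp at hl

theorem MInv.step {x y : X} {b d : Bool} {F F' : List X → ℤ} (h : MStep x b F F')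
    (hF : MInv y d F) (hxy : x = y → b = d) : MInv x b F' := by
  obtain ⟨v, c, e, hv, hvy, hc, hFv, hFyv, he, hz1, hz2⟩ := hF
  by_cases hx : x = y
  · obtain rfl := hxy hx
    subst hx
    refine ⟨v, c, e + (if b then 1 else -1), hv, hvy, hc, ?_, ?_, ?_, ?_, ?_⟩
    · rw [(h v hvy).1, hFv]
    · rw [(h v hvy).2, hFv, hFyv]; ring
    · cases b <;> simp at he ⊢ <;> omega
    · intro w h1 h2 h3
      rw [(h w h2).1, hz1 w h1 h2 h3]
    · intro w h1 h2
      have h3 := alt_cons.mp h1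
      rw [(h w h3.1).2, hz2 w h1 h2, hz1 w h3.2 h3.1 h2]; simp
  · have hh : (y :: v).head? ≠ some x := by simpa using fun h => hx h.symm
    have ha : Alt (y :: v) := alt_cons.mpr ⟨hvy, hv⟩
    have hec : e * c ≠ 0 := by
      refine mul_ne_zero ?_ hc
      rintro rfl
      cases b <;> cases d <;> simp at he
    have key : ∀ w, Alt w → v.length + 1 < w.length → F w = 0 := by
      intro w h1 h2
      by_cases h3 : w.head? = some y
      · obtain ⟨w', rfl⟩ : ∃ w', w = y :: w' := by
          cases w with
          | nil => simp at h3
          | cons a w => simp at h3; exact ⟨w, by rw [h3]⟩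
        exact hz2 w' h1 (by simpa using h2)
      · exact hz1 w h1 h3 (by omega)
    refine ⟨y :: v, e * c, if b then 1 else -1, ha, hh, hec, ?_, ?_, ?_, ?_, ?_⟩
    · rw [(h _ hh).1, hFyv]
    · rw [(h _ hh).2, hFyv, key (x :: y :: v) (alt_cons.mpr ⟨hh, ha⟩) (by simp)]; simp
    · cases b <;> simp
    · intro w h1 h2 h3
      rw [(h w h2).1, key w h1 (by simpa using h3)]
    · intro w h1 h2
      have h3 := alt_cons.mp h1
      simp at h2
      rw [(h w h3.1).2, key w h3.2 h2, key _ h1 (by simp; omega)]; simp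

open PowerSeries

/-- The noncommutative polynomial ring. -/
abbrev NC (X : Type*) := MonoidAlgebra ℤ (FreeMonoid X)

noncomputable def ncx (x : X) : NC X := MonoidAlgebra.single (FreeMonoid.of x) 1

noncomputable def mcoef (f : PowerSeries (NC X)) (w : List X) : ℤ :=
  (coeff w.length f).coeff (FreeMonoid.ofList w)

noncomputable def magUnit (x : X) : (PowerSeries (NC X))ˣ where
  val := 1 + PowerSeries.X * C (ncx x)
  inv := PowerSeries.mk fun n => (- ncx x) ^ n
  val_inv := by
    ext1 n
    cases n with
    | zero => simp [add_mul, mul_assoc]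
    | succ n => simp [add_mul, mul_assoc, PowerSeries.coeff_succ_X_mul, pow_succ', coeff_one]
  inv_val := by
    ext1 n
    cases n with
    | zero => simp [mul_add]
    | succ n =>
      rw [mul_add, mul_one, ← mul_assoc, (PowerSeries.commute_X _).eq, mul_assoc]
      simp [PowerSeries.coeff_succ_X_mul, PowerSeries.coeff_mul_C, pow_succ, coeff_one]

noncomputable def magnus (X : Type*) : FreeGroup X →* (PowerSeries (NC X))ˣ :=
  FreeGroup.lift magUnit

theorem magnus_coeff_zero (g : FreeGroup X) : coeff 0 (magnus X g : PowerSeries (NC X)) = 1 := by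
  induction g using FreeGroup.induction_on with
  | C1 => simp
  | of x => simp [magnus, magUnit]
  | inv_of x h => simp [magnus, magUnit]
  | mul a b ha hb => 
    simp only [map_mul, Units.val_mul, PowerSeries.coeff_zero_eq_constantCoeff_apply] at *
    rw [ha, hb, one_mul]

theorem mcoef_nil (x : X) (f : PowerSeries (NC X)) :
    mcoef ((magUnit x : PowerSeries (NC X)) * f) [] = mcoef f [] := by
  simp [mcoef, magUnit, add_mul, mul_assoc]

theorem mcoef_cons_same (x : X) (f : PowerSeries (NC X)) (w : List X) :
    mcoef ((magUnit x : PowerSeries (NC X)) * f) (x :: w) = mcoef f (x :: w) + mcoef f w := by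
  simp only [mcoef, magUnit, add_mul, mul_assoc, one_mul, List.length_cons, map_add,
    PowerSeries.coeff_succ_X_mul, PowerSeries.coeff_C_mul, MonoidAlgebra.coeff_add,
    Finsupp.add_apply, ncx, FreeMonoid.ofList_cons, MonoidAlgebra.coeff_single_mul_mul]

theorem mcoef_cons_ne {x y : X} (hxy : y ≠ x) (f : PowerSeries (NC X)) (w : List X) :
    mcoef ((magUnit x : PowerSeries (NC X)) * f) (y :: w) = mcoef f (y :: w) := by
  simp only [mcoef, magUnit, add_mul, mul_assoc, one_mul, List.length_cons, map_add,
    PowerSeries.coeff_succ_X_mul, PowerSeries.coeff_C_mul, MonoidAlgebra.coeff_add,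
    Finsupp.add_apply, ncx, FreeMonoid.ofList_cons]
  rw [MonoidAlgebra.coeff_single_mul_of_forall_mul_ne]
  · simp
  · intro d hd
    have := congrArg FreeMonoid.toList hd
    simp at this
    exact hxy this.1.symm

theorem mstep_true (x : X) (f : PowerSeries (NC X)) :
    MStep x true (mcoef f) (mcoef ((magUnit x : PowerSeries (NC X)) * f)) := by
  intro w hw
  rw [mcoef_cons_same]
  refine ⟨?_, by simp⟩
  cases w with
  | nil => exact mcoef_nil x f
  | cons y w => exact mcoef_cons_ne (by simpa using hw) f w

theorem mstep_false (x : X) (f : PowerSeries (NC X)) :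
    MStep x false (mcoef f) (mcoef (((magUnit x)⁻¹ : (PowerSeries (NC X))ˣ) * f)) := by
  intro w hw
  set f' := (((magUnit x)⁻¹ : (PowerSeries (NC X))ˣ) * f : PowerSeries (NC X)) with hf'
  have hf : f = (magUnit x : PowerSeries (NC X)) * f' := by simp [hf']
  obtain ⟨h1, h2⟩ := mstep_true x f' w hw
  rw [← hf] at h1 h2
  rw [h1, h2, ]
  simp

theorem magnus_inv (L : List (X × Bool)) (a : X × Bool)
    (hL : FreeGroup.IsReduced (a :: L)) :
    MInv a.1 a.2 (mcoef (magnus X (FreeGroup.mk (a :: L)) : PowerSeries (NC X))) := by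
  induction L generalizing a with
  | nil =>
    obtain ⟨x, b⟩ := a
    have h0 : mcoef (1 : PowerSeries (NC X)) [] = 1 := by
      simp [mcoef, MonoidAlgebra.one_def]
    have h1 : ∀ w : List X, w ≠ [] → mcoef (1 : PowerSeries (NC X)) w = 0 := by
      intro w hw
      simp [mcoef, PowerSeries.coeff_one, hw]
    cases b
    · have := MInv.base (mstep_false x (1 : PowerSeries (NC X))) h0 h1
      simpa [magnus] using this
    · have := MInv.base (mstep_true x (1 : PowerSeries (NC X))) h0 h1
      simpa [magnus] using this
  | cons a' L ih =>
    obtain ⟨x, b⟩ := a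
    obtain ⟨y, d⟩ := a'
    have h1 := ih (y, d) (by
      unfold FreeGroup.IsReduced at *; exact (List.isChain_cons_cons.mp hL).2)
    have hxy : x = y → b = d := (List.isChain_cons_cons.mp hL).1
    have hm : FreeGroup.mk ((x, b) :: (y, d) :: L) =
        FreeGroup.mk [(x, b)] * FreeGroup.mk ((y, d) :: L) := by simp
    rw [hm, map_mul, Units.val_mul]
    cases b
    · have := MInv.step (mstep_false x _) h1 hxy
      simpa [magnus] using this
    · have := MInv.step (mstep_true x _) h1 hxy
      simpa [magnus] using this

theorem magnus_injective (g : FreeGroup X) (h : (magnus X g : PowerSeries (NC X)) = 1) :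
    g = 1 := by
  classical
  rcases hL : g.toWord with _ | ⟨a, L⟩
  · rwa [FreeGroup.toWord_eq_nil_iff] at hL
  · have hred : FreeGroup.IsReduced (a :: L) := hL ▸ FreeGroup.isReduced_toWord
    obtain ⟨v, c, e, -, -, hc, h1, h2, h3, -⟩ := magnus_inv L a hred
    rw [← hL, FreeGroup.mk_toWord, h] at h2
    have : mcoef (1 : PowerSeries (NC X)) (a.1 :: v) = 0 := by
      simp [mcoef, PowerSeries.coeff_one]
    rw [this] at h2
    rcases zero_eq_mul.mp h2 with rfl | h
    · simp at h3
    · exact absurd h hc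

/-- Positivity of noncommutative polynomials. -/
def ncPos [LinearOrder X] (a : NC X) : Prop :=
  ∃ i : List X, (∀ j < i, a.coeff (FreeMonoid.ofList j) = 0) ∧ 0 < a.coeff (FreeMonoid.ofList i)

theorem ncPos_isPos [LinearOrder X] : IsPos (ncPos (X := X)) := by
  refine ⟨?_, ?_, ?_⟩
  · rintro ⟨i, -, h⟩
    simp at h
  · rintro a b ⟨i, h1, h2⟩ ⟨j, h3, h4⟩
    rcases lt_trichotomy i j with hd | rfl | hd
    · refine ⟨i, fun k hk => ?_, ?_⟩
      · simp [h1 k hk, h3 k (hk.trans hd)]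
      · simpa [h3 i hd] using h2
    · refine ⟨i, fun k hk => ?_, ?_⟩
      · simp [h1 k hk, h3 k hk]
      · simpa using add_pos h2 h4
    · refine ⟨j, fun k hk => ?_, ?_⟩
      · simp [h3 k hk, h1 k (hk.trans hd)]
      · simpa [h1 j hd] using h4
  · intro a ha
    have hne : a.coeff ≠ 0 := fun h => ha (MonoidAlgebra.coeff_injective (by simpa using h))
    let s : Finset (List X) := a.coeff.support.map FreeMonoid.toList.toEmbedding
    have hs : s.Nonempty := by
      simpa [s, Finset.map_nonempty] using hne
    have hmin := s.min'_mem hs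
    have hlt : ∀ j < s.min' hs, a.coeff (FreeMonoid.ofList j) = 0 := by
      intro j hj
      by_contra hh
      have : j ∈ s := by
        simp only [s, Finset.mem_map, Finsupp.mem_support_iff]
        exact ⟨FreeMonoid.ofList j, hh, by simp⟩
      exact absurd (s.min'_le j this) (not_le.mpr hj)
    have hnz : a.coeff (FreeMonoid.ofList (s.min' hs)) ≠ 0 := by
      obtain ⟨u, hu, hu2⟩ := Finset.mem_map.mp hmin
      rw [← hu2]
      simpa using hu
    rcases lt_or_gt_of_ne hnz with h | h
    · right
      exact ⟨_, fun j hj => by simp [hlt j hj], by simpa using h⟩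
    · left
      exact ⟨_, hlt, h⟩

/-- The Magnus cone. -/
def magCone (X : Type*) [LinearOrder X] : Set (FreeGroup X) :=
  {g | PPos ncPos ((magnus X g : PowerSeries (NC X)) - 1)}

theorem magCone_isCone [LinearOrder X] : IsCone (magCone X) :=
  cone_of_hom ncPos_isPos (magnus X) magnus_coeff_zero magnus_injective

theorem magnus_map (φ : X → X) (g : FreeGroup X) :
    (magnus X (FreeGroup.map φ g) : PowerSeries (NC X)) =
      PowerSeries.map (MonoidAlgebra.mapDomainRingHom ℤ (FreeMonoid.map φ)) (magnus X g) := by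
  have : (magnus X).comp (FreeGroup.map φ) = (Units.map (PowerSeries.map
      (MonoidAlgebra.mapDomainRingHom ℤ (FreeMonoid.map φ)) : 
        PowerSeries (NC X) →* PowerSeries (NC X))).comp (magnus X) := by
    ext x : 1
    ext1
    simp [magnus, magUnit, ncx]
  have h2 := congrArg Units.val (DFunLike.congr_fun this g)
  simpa using h2

theorem list_map_lt [LinearOrder X] {φ : X → X} (hφ : StrictMono φ) {l l' : List X} (h : l < l') :
    l.map φ < l'.map φ := by
  induction l generalizing l' with
  | nil =>
    cases l' with
    | nil => simp at h
    | cons => simp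
  | cons a l ih =>
    cases l' with
    | nil => simp at h
    | cons b l' =>
      simp only [List.map_cons, List.cons_lt_cons_iff] at h ⊢
      rcases h with h | ⟨rfl, h⟩
      · exact Or.inl (hφ h)
      · exact Or.inr ⟨rfl, ih h⟩

theorem ncPos_map [LinearOrder X] (φ : X ≃ X) (hφ : StrictMono φ) {a : NC X} (ha : ncPos a) :
    ncPos (MonoidAlgebra.mapDomainRingHom ℤ (FreeMonoid.map φ) a) := by
  obtain ⟨i, h1, h2⟩ := ha
  have hφ' : StrictMono φ.symm := by
    intro x y hxy
    rcases lt_trichotomy (φ.symm x) (φ.symm y) with h | h | h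
    · exact h
    · exact absurd (φ.symm.injective h) hxy.ne
    · have := hφ h
      simp at this
      exact absurd hxy this.asymm
  have hinj : Function.Injective (FreeMonoid.map φ) := by
    intro u v huv
    have := congrArg FreeMonoid.toList huv
    simp only [FreeMonoid.toList_map] at this
    exact FreeMonoid.toList.injective (List.map_injective_iff.mpr φ.injective this)
  have key : ∀ l : List X, (MonoidAlgebra.mapDomainRingHom ℤ (FreeMonoid.map φ) a).coeff
      (FreeMonoid.ofList (l.map φ)) = a.coeff (FreeMonoid.ofList l) := by
    intro l
    have : FreeMonoid.ofList (l.map φ) = FreeMonoid.map φ (FreeMonoid.ofList l) := rfl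
    rw [this]
    simp only [MonoidAlgebra.mapDomainRingHom_apply, MonoidAlgebra.coeff_mapDomain]
    exact Finsupp.mapDomain_apply hinj _ _
  refine ⟨i.map φ, fun j hj => ?_, by rw [key]; exact h2⟩
  have hj' : j = (j.map φ.symm).map φ := by simp
  rw [hj', key]
  apply h1
  have := list_map_lt hφ' hj
  simpa using this

theorem magCone_map [LinearOrder X] (φ : X ≃ X) (hφ : StrictMono φ) {g : FreeGroup X}
    (hg : g ∈ magCone X) : FreeGroup.map φ g ∈ magCone X := by
  obtain ⟨d, h1, h2⟩ := hg
  have key : (magnus X (FreeGroup.map φ g) : PowerSeries (NC X)) - 1 = 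
      PowerSeries.map (MonoidAlgebra.mapDomainRingHom ℤ (FreeMonoid.map φ))
        ((magnus X g : PowerSeries (NC X)) - 1) := by
    rw [magnus_map]; simp
  refine ⟨d, fun j hj => ?_, ?_⟩
  · rw [key, PowerSeries.coeff_map, h1 j hj, map_zero]
  · rw [key, PowerSeries.coeff_map]
    exact ncPos_map φ hφ h2

end Magnus

theorem biOrd_freeGroup (X : Type*) : BiOrd (FreeGroup X) := by
  classical
  let := linearOrderOfSTO (WellOrderingRel (α := X))
  exact ⟨_, magCone_isCone (X := X)⟩

end OrdWP

namespace OrdWP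

section Star
variable {G : Type*} [Group G] {X : Type*} [MulAction G X]

/-- The action of a group on the free group of a `G`-set. -/
def frAct (G : Type*) [Group G] (X : Type*) [MulAction G X] : G →* MulAut (FreeGroup X) where
  toFun g := FreeGroup.freeGroupCongr (MulAction.toPerm g)
  map_one' := by
    ext x
    induction x using FreeGroup.induction_on <;> simp_all
  map_mul' a b := by
    ext x
    induction x using FreeGroup.induction_on <;> simp_all [mul_smul]

@[simp] theorem frAct_of (g : G) (x : X) :
    frAct G X g (FreeGroup.of x) = FreeGroup.of (g • x) := by simp [frAct]

theorem frAct_eq (g : G) (f : FreeGroup X) :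
    frAct G X g f = FreeGroup.map (MulAction.toPerm g) f := rfl

abbrev SD (G : Type*) [Group G] (X : Type*) [MulAction G X] := FreeGroup X ⋊[frAct G X] G

theorem magCone_act [LinearOrder X] (hX : ∀ g : G, StrictMono (fun x : X => g • x)) (g : G)
    {f : FreeGroup X} (hf : f ∈ magCone X) : frAct G X g f ∈ magCone X := by
  rw [frAct_eq]
  exact magCone_map _ (hX g) hf

theorem biOrd_sd [LinearOrder X] (hX : ∀ g : G, StrictMono (fun x : X => g • x))
    (hG : BiOrd G) : BiOrd (SD G X) := by
  obtain ⟨P, hP⟩ := hG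
  have hC := magCone_isCone (X := X)
  refine ⟨{x | x.right ∈ P ∨ (x.right = 1 ∧ x.left ∈ magCone X)}, ?_, ?_, ?_, ?_⟩
  · simp [hP.one, hC.one]
  · rintro a ha b hb
    simp only [Set.mem_ofPred_eq, SemidirectProduct.mul_right, SemidirectProduct.mul_left] at *
    rcases ha with ha | ⟨ha, ha'⟩ <;> rcases hb with hb | ⟨hb, hb'⟩
    · exact Or.inl (hP.mul _ ha _ hb)
    · left; simpa [hb] using ha
    · left; simpa [ha] using hb
    · right; exact ⟨by simp [ha, hb], hC.mul _ ha' _ (magCone_act hX _ hb')⟩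
  · rintro a ha b
    simp only [Set.mem_ofPred_eq] at *
    rcases ha with ha | ⟨ha, ha'⟩
    · left; simpa using hP.conj _ ha b.right
    · right
      refine ⟨by simp [ha], ?_⟩
      have := hC.conj _ (magCone_act hX b.right ha') b.left
      simpa [ha] using this
  · rintro a ha
    simp only [Set.mem_ofPred_eq]
    by_cases h : a.right = 1
    · have h1 : a.left ≠ 1 := by
        intro h1; apply ha
        exact SemidirectProduct.ext h1 h
      rcases hC.total _ h1 with h2 | h2
      · exact Or.inl (Or.inr ⟨h, h2⟩)
      · right; right; simpa [h] using h2
    · rcases hP.total _ h with h2 | h2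
      · exact Or.inl (Or.inl h2)
      · right; left; simpa using h2

/-- A relatively convex subgroup with its cone. -/
structure RelCone (M : Subgroup G) (P : Set G) : Prop where
  disj : ∀ a ∈ M, a ∉ P
  mul : ∀ a ∈ P, ∀ b ∈ P, a * b ∈ P
  left : ∀ m ∈ M, ∀ a ∈ P, m * a ∈ P
  right : ∀ a ∈ P, ∀ m ∈ M, a * m ∈ P
  total : ∀ a, a ∉ M → a ∈ P ∨ a⁻¹ ∈ P

theorem RelCone.order {M : Subgroup G} {P : Set G} (h : RelCone M P) :
    ∃ _ : LinearOrder (G ⧸ M), ∀ g : G, StrictMono (fun x : G ⧸ M => g • x) := by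
  classical
  let lt : G ⧸ M → G ⧸ M → Prop := fun x y => x.out⁻¹ * y.out ∈ P
  have hlt : ∀ a b : G, lt (a : G ⧸ M) (b : G ⧸ M) ↔ a⁻¹ * b ∈ P := by
    intro a b
    obtain ⟨m, hm⟩ := QuotientGroup.mk_out_eq_mul M a
    obtain ⟨n, hn⟩ := QuotientGroup.mk_out_eq_mul M b
    simp only [lt, hm, hn]
    constructor
    · intro h1
      have := h.left _ m.2 _ (h.right _ h1 _ (M.inv_mem n.2))
      simpa [mul_assoc] using this
    · intro h1
      have := h.left _ (M.inv_mem m.2) _ (h.right _ h1 _ n.2)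
      simpa [mul_assoc] using this
  have sto : IsStrictTotalOrder (G ⧸ M) lt := by
    refine { trichotomous := ?_, irrefl := ?_, trans := ?_ }
    · intro x y
      induction x using QuotientGroup.induction_on with | _ a
      induction y using QuotientGroup.induction_on with | _ b
      rw [hlt, hlt]
      intro h1 h2
      rw [QuotientGroup.eq]
      by_contra h3
      rcases h.total _ h3 with h4 | h4
      · exact h1 h4
      · exact h2 (by simpa using h4)
    · intro x
      induction x using QuotientGroup.induction_on with | _ a
      rw [hlt]
      simpa using h.disj 1 M.one_mem
    · intro x y z
      induction x using QuotientGroup.induction_on with | _ a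
      induction y using QuotientGroup.induction_on with | _ b
      induction z using QuotientGroup.induction_on with | _ c
      rw [hlt, hlt, hlt]
      intro h1 h2
      simpa [mul_assoc] using h.mul _ h1 _ h2
  refine ⟨linearOrderOfSTO lt, ?_⟩
  intro g x y
  induction x using QuotientGroup.induction_on with | _ a
  induction y using QuotientGroup.induction_on with | _ b
  intro h1
  have h1' : lt a b := h1
  change lt (g • (a : G ⧸ M)) (g • (b : G ⧸ M))
  rw [MulAction.Quotient.smul_coe, MulAction.Quotient.smul_coe, hlt]
  rw [hlt] at h1'
  simpa [mul_assoc] using h1'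

/-- Centralizer extensions. -/
abbrev CE (G : Type*) [Group G] (M : Subgroup G) := SD G (G ⧸ M)

theorem biOrd_ce {M : Subgroup G} {P : Set G} (h : RelCone M P) (hG : BiOrd G) :
    BiOrd (CE G M) := by
  obtain ⟨_, hX⟩ := h.order
  exact biOrd_sd hX hG

/-- The stable letter. -/
def stab (G : Type*) [Group G] (M : Subgroup G) : CE G M :=
  SemidirectProduct.inl (FreeGroup.of ((1 : G) : G ⧸ M))

theorem inr_conj_inl_of (g : G) (x : X) :
    (SemidirectProduct.inr g * SemidirectProduct.inl (FreeGroup.of x) *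
      (SemidirectProduct.inr g)⁻¹ : SD G X) = SemidirectProduct.inl (FreeGroup.of (g • x)) := by
  rw [← frAct_of, SemidirectProduct.inl_aut, map_inv]

theorem conj_stab (M : Subgroup G) (g : G) :
    (SemidirectProduct.inr g * stab G M * (SemidirectProduct.inr g)⁻¹ : CE G M) =
      SemidirectProduct.inl (FreeGroup.of (g : G ⧸ M)) := by
  rw [stab, inr_conj_inl_of, MulAction.Quotient.smul_coe]; simp

theorem stab_commute (M : Subgroup G) (g : G) :
    Commute (SemidirectProduct.inr g : CE G M) (stab G M) ↔ g ∈ M := by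
  have h : Commute (SemidirectProduct.inr g : CE G M) (stab G M) ↔
      (SemidirectProduct.inr g * stab G M * (SemidirectProduct.inr g)⁻¹ : CE G M) = stab G M := by
    rw [mul_inv_eq_iff_eq_mul]; rfl
  rw [h, conj_stab, stab, SemidirectProduct.inl_inj, FreeGroup.of_injective.eq_iff, eq_comm,
    QuotientGroup.eq]
  simp

/-- Universal property of centralizer extensions. -/
theorem ce_lift {H : Type*} [Group H] {M : Subgroup G} (θ : G →* H) (k : H)
    (hk : ∀ m ∈ M, Commute (θ m) k) :
    ∃ Θ : CE G M →* H, (∀ g, Θ (SemidirectProduct.inr g) = θ g) ∧ Θ (stab G M) = k := by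
  let F : G ⧸ M → H := Quotient.lift (fun g => θ g * k * (θ g)⁻¹) (by
    intro a b hab
    have hab' : a⁻¹ * b ∈ M := QuotientGroup.leftRel_apply.mp hab
    have h1 := hk _ hab'
    rw [map_mul, map_inv] at h1
    have h2 : (θ a)⁻¹ * θ b * k = k * ((θ a)⁻¹ * θ b) := h1
    change θ a * k * (θ a)⁻¹ = θ b * k * (θ b)⁻¹
    rw [mul_inv_eq_iff_eq_mul, ← mul_right_inj (θ a)⁻¹, ← mul_left_inj ((θ a)⁻¹ * θ b)]
    simp only [mul_assoc, inv_mul_cancel_left, mul_inv_cancel_left, inv_mul_cancel, mul_one] at h2 ⊢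
    exact h2.symm)
  have hF : ∀ g : G, F (g : G ⧸ M) = θ g * k * (θ g)⁻¹ := fun g => rfl
  refine ⟨SemidirectProduct.lift (FreeGroup.lift F) θ ?_, ?_, ?_⟩
  · intro g
    ext x
    induction x using QuotientGroup.induction_on with | _ a
    simp [hF, mul_assoc]
  · intro g; simp
  · simp [stab, hF]

end Star

section Second
variable {G : Type*} [Group G] {X : Type*} [MulAction G X]

open Classical in
/-- Retraction onto the free subgroup on `Y`. -/
noncomputable def ret (Y : Set X) : FreeGroup X →* FreeGroup X :=
  FreeGroup.lift fun x => if x ∈ Y then FreeGroup.of x else 1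

theorem ret_of_mem {Y : Set X} {x : X} (hx : x ∈ Y) : ret Y (FreeGroup.of x) = FreeGroup.of x := by
  simp [ret, hx]

theorem ret_of_not_mem {Y : Set X} {x : X} (hx : x ∉ Y) : ret Y (FreeGroup.of x) = 1 := by
  simp [ret, hx]

theorem ret_ret (Y : Set X) (f : FreeGroup X) : ret Y (ret Y f) = ret Y f := by
  have : (ret Y).comp (ret Y) = ret Y := by
    ext x
    by_cases hx : x ∈ Y
    · simp [ret_of_mem hx]
    · simp [ret_of_not_mem hx]
  exact DFunLike.congr_fun this f

theorem ret_act {Y : Set X} {g : G} (hg : ∀ x, g • x ∈ Y ↔ x ∈ Y) (f : FreeGroup X) :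
    ret Y (frAct G X g f) = frAct G X g (ret Y f) := by
  have : (ret Y).comp (frAct G X g).toMonoidHom = (frAct G X g).toMonoidHom.comp (ret Y) := by
    ext x
    by_cases hx : x ∈ Y
    · simp [ret_of_mem hx, ret_of_mem ((hg x).mpr hx)]
    · simp [ret_of_not_mem hx, ret_of_not_mem (mt (hg x).mp hx)]
  exact DFunLike.congr_fun this f

/-- The subgroup generated by `K` and the free generators in `Y`. -/
def subM (K : Subgroup G) (Y : Set X) (hY : ∀ g ∈ K, ∀ x, g • x ∈ Y ↔ x ∈ Y) :
    Subgroup (SD G X) where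
  carrier := {x | x.right ∈ K ∧ ret Y x.left = x.left}
  one_mem' := by simp [K.one_mem]
  mul_mem' := by
    rintro a b ⟨h1, h2⟩ ⟨h3, h4⟩
    refine ⟨by simpa using K.mul_mem h1 h3, ?_⟩
    simp [h2, ret_act (hY _ h1), h4]
  inv_mem' := by
    rintro a ⟨h1, h2⟩
    refine ⟨by simpa using h1, ?_⟩
    have := ret_act (hY _ (K.inv_mem h1)) a.left⁻¹
    have h3 : ret Y a.left⁻¹ = a.left⁻¹ := by rw [map_inv, h2]
    rw [h3] at this
    exact this

theorem relCone_subM [LinearOrder X] (hX : ∀ g : G, StrictMono (fun x : X => g • x))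
    {K : Subgroup G} {P : Set G} (hP : RelCone K P) (Y : Set X)
    (hY : ∀ g ∈ K, ∀ x, g • x ∈ Y ↔ x ∈ Y) :
    RelCone (subM K Y hY) {x | x.right ∈ P ∨
      (x.right ∈ K ∧ x.left * (ret Y x.left)⁻¹ ∈ magCone X)} := by
  have hC := magCone_isCone (X := X)
  refine ⟨?_, ?_, ?_, ?_, ?_⟩
  · rintro a ⟨h1, h2⟩ (h3 | ⟨-, h3⟩)
    · exact hP.disj _ h1 h3
    · rw [h2] at h3
      exact hC.one (by simpa using h3)
  · rintro a (ha | ⟨ha, ha'⟩) b (hb | ⟨hb, hb'⟩)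
    · left; simpa using hP.mul _ ha _ hb
    · left; simpa using hP.right _ ha _ hb
    · left; simpa using hP.left _ ha _ hb
    · right
      refine ⟨by simpa using K.mul_mem ha hb, ?_⟩
      have h1 := hC.mul _ (hC.conj _ (magCone_act hX a.right hb') a.left) _ ha'
      have h2 : frAct G X a.right (ret Y b.left) = ret Y (frAct G X a.right b.left) :=
        (ret_act (hY _ ha) _).symm
      simpa [h2, mul_assoc] using h1
  · rintro m ⟨hm, hm'⟩ a (ha | ⟨ha, ha'⟩)
    · left; simpa using hP.left _ hm _ ha
    · right
      refine ⟨by simpa using K.mul_mem hm ha, ?_⟩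
      have h1 := hC.conj _ (magCone_act hX m.right ha') m.left
      have h2 : frAct G X m.right (ret Y a.left) = ret Y (frAct G X m.right a.left) :=
        (ret_act (hY _ hm) _).symm
      simpa [h2, mul_assoc, hm'] using h1
  · rintro a (ha | ⟨ha, ha'⟩) m ⟨hm, hm'⟩
    · left; simpa using hP.right _ ha _ hm
    · right
      refine ⟨by simpa using K.mul_mem ha hm, ?_⟩
      have h2 : ret Y (frAct G X a.right m.left) = frAct G X a.right m.left := by
        rw [ret_act (hY _ ha), hm']
      simpa [h2, mul_assoc] using ha'
  · intro a ha
    by_cases hr : a.right ∈ K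
    · have h1 : a.left * (ret Y a.left)⁻¹ ≠ 1 := by
        rw [Ne, mul_inv_eq_one]
        exact fun h => ha ⟨hr, h.symm⟩
      rcases hC.total _ h1 with h2 | h2
      · exact Or.inl (Or.inr ⟨hr, h2⟩)
      · right; right
        refine ⟨by simpa using hr, ?_⟩
        have h3 := magCone_act hX a.right⁻¹ (hC.conj _ h2 a.left⁻¹)
        have h4 : frAct G X a.right⁻¹ (ret Y a.left) = ret Y (frAct G X a.right⁻¹ a.left) :=
          (ret_act (hY _ (K.inv_mem hr)) _).symm
        simp only [map_inv, MulAut.inv_apply] at h4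
        simpa [mul_assoc, h4] using h3
    · rcases hP.total _ hr with h | h
      · exact Or.inl (Or.inl h)
      · right; left; simpa using h

end Second
end OrdWP

namespace OrdWP

section Graph
variable {A B : Type*} [Group A] [Group B]

/-- The graph of a homomorphism. -/
def gr (φ : A →* B) : Subgroup (A × B) where
  carrier := {x | x.2 = φ x.1}
  one_mem' := by simp
  mul_mem' := by
    rintro ⟨a, b⟩ ⟨c, d⟩ h1 h2
    simp only [Set.mem_ofPred_eq, Prod.mk_mul_mk] at *
    simp [h1, h2]
  inv_mem' := by
    rintro ⟨a, b⟩ h1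
    simp only [Set.mem_ofPred_eq, Prod.inv_mk] at *
    simp [h1]

theorem mem_gr {φ : A →* B} {x : A × B} : x ∈ gr φ ↔ x.2 = φ x.1 := Iff.rfl

theorem relCone_gr (φ : A →* B) {P : Set B} (hP : IsCone P) :
    RelCone (gr φ) {x | x.2 * (φ x.1)⁻¹ ∈ P} := by
  refine ⟨?_, ?_, ?_, ?_, ?_⟩
  · rintro ⟨a, b⟩ h1 h2
    simp only [mem_gr, Set.mem_ofPred_eq] at *
    rw [h1] at h2
    exact hP.one (by simpa using h2)
  · rintro ⟨a, b⟩ h1 ⟨c, d⟩ h2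
    simp only [Set.mem_ofPred_eq, Prod.mk_mul_mk] at *
    have := hP.mul _ (hP.conj _ h2 b) _ h1
    simpa [mul_assoc] using this
  · rintro ⟨a, b⟩ h1 ⟨c, d⟩ h2
    simp only [mem_gr, Set.mem_ofPred_eq, Prod.mk_mul_mk] at *
    have := hP.conj _ h2 b
    rw [h1] at this ⊢
    simpa [mul_assoc] using this
  · rintro ⟨a, b⟩ h1 ⟨c, d⟩ h2
    simp only [mem_gr, Set.mem_ofPred_eq, Prod.mk_mul_mk] at *
    rw [h2]
    simpa [mul_assoc] using h1
  · rintro ⟨a, b⟩ h1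
    simp only [mem_gr, Set.mem_ofPred_eq, Prod.inv_mk] at *
    rcases hP.total (b * (φ a)⁻¹) (by rwa [Ne, mul_inv_eq_one]) with h | h
    · exact Or.inl h
    · right
      have := hP.conj _ h b⁻¹
      simpa [mul_assoc] using this

variable (α β : A →* B)

abbrev Gam1 := CE (A × B) (gr β)

/-- The orbit of the base coset. -/
def orbY : Set ((A × B) ⧸ gr β) := {x | ∃ l ∈ gr α, x = (l : (A × B) ⧸ gr β)}

theorem orbY_inv : ∀ g ∈ gr α, ∀ x : (A × B) ⧸ gr β, g • x ∈ orbY α β ↔ x ∈ orbY α β := by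
  have key : ∀ g ∈ gr α, ∀ x ∈ orbY α β, g • x ∈ orbY α β := by
    rintro g hg x ⟨l, hl, rfl⟩
    exact ⟨g * l, mul_mem hg hl, by simp⟩
  intro g hg x
  refine ⟨fun h => ?_, key g hg x⟩
  have := key g⁻¹ (inv_mem hg) _ h
  simpa using this

abbrev subMM : Subgroup (Gam1 β) := subM (gr α) (orbY α β) (orbY_inv α β)

abbrev Gam := CE (Gam1 β) (subMM α β)

theorem biOrd_gam (hA : BiOrd A) (hB : BiOrd B) : BiOrd (Gam α β) := by
  obtain ⟨P, hP⟩ := hB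
  obtain ⟨_, hX⟩ := (relCone_gr β hP).order
  exact biOrd_ce (relCone_subM hX (relCone_gr α hP) (orbY α β) (orbY_inv α β))
    (biOrd_sd hX (hA.prod ⟨P, hP⟩))

def gL : A × B →* Gam α β := SemidirectProduct.inr.comp SemidirectProduct.inr
def gt : Gam α β := SemidirectProduct.inr (stab _ _)
def gk : Gam α β := stab _ _

theorem gt_commute (l : A × B) (hl : l ∈ gr β) : Commute (gL α β l) (gt α β) :=
  ((stab_commute (gr β) l).mpr hl).map (SemidirectProduct.inr : Gam1 β →* Gam α β)

theorem gk_commute (l : A × B) (hl : l ∈ gr α) : Commute (gL α β l) (gk α β) :=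
  (stab_commute (subMM α β) _).mpr ⟨by simpa using hl, by simp⟩

theorem inl_of_mem (x : (A × B) ⧸ gr β) :
    (SemidirectProduct.inl (FreeGroup.of x) : Gam1 β) ∈ subMM α β ↔ x ∈ orbY α β := by
  constructor
  · rintro ⟨-, h⟩
    by_contra hx
    simp only [SemidirectProduct.left_inl] at h
    rw [ret_of_not_mem hx] at h
    exact FreeGroup.of_ne_one x h.symm
  · intro h
    exact ⟨by simp, by simpa using ret_of_mem h⟩

theorem gk_gt_commute : Commute (gt α β) (gk α β) :=
  (stab_commute (subMM α β) _).mpr ((inl_of_mem α β _).mpr ⟨1, one_mem _, rfl⟩)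

theorem key_commute (w : B) :
    Commute (gL α β (1, w) * gt α β * (gL α β (1, w))⁻¹) (gk α β) ↔
      ∃ u, w = α u * (β u)⁻¹ := by
  have h1 : gL α β (1, w) * gt α β * (gL α β (1, w))⁻¹ =
      SemidirectProduct.inr (SemidirectProduct.inl
        (FreeGroup.of (((1, w) : A × B) : (A × B) ⧸ gr β)) : Gam1 β) := by
    rw [← conj_stab]
    simp [gL, gt]
  rw [h1, gk, stab_commute, inl_of_mem]
  constructor
  · rintro ⟨⟨u, v⟩, hl, h⟩
    rw [mem_gr] at hl
    simp only at hl
    subst hl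
    rw [eq_comm, QuotientGroup.eq, mem_gr] at h
    simp only [Prod.inv_mk, Prod.mk_mul_mk, mul_one, map_inv] at h
    exact ⟨u, by rw [← h]; simp⟩
  · rintro ⟨u, rfl⟩
    refine ⟨(u, α u), rfl, ?_⟩
    rw [eq_comm, QuotientGroup.eq, mem_gr]
    simp

/-- Universal property of the big group. -/
theorem gam_lift {H : Type*} [Group H] (θ : A × B →* H) (t k : H)
    (ht : ∀ l ∈ gr β, Commute (θ l) t) (hk : ∀ l ∈ gr α, Commute (θ l) k) (htk : Commute t k) :
    ∃ Θ : Gam α β →* H, (∀ l, Θ (gL α β l) = θ l) ∧ Θ (gt α β) = t ∧ Θ (gk α β) = k := by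
  obtain ⟨θ1, h1, h2⟩ := ce_lift θ t ht
  have hM : ∀ m ∈ subMM α β, Commute (θ1 m) k := by
    rintro m ⟨hm1, hm2⟩
    have hf : ∀ f : FreeGroup ((A × B) ⧸ gr β),
        Commute (θ1 (SemidirectProduct.inl (ret (orbY α β) f))) k := by
      intro f
      induction f using FreeGroup.induction_on with
      | C1 => simp
      | of x =>
        by_cases hx : x ∈ orbY α β
        · rw [ret_of_mem hx]
          obtain ⟨l, hl, rfl⟩ := hx
          rw [← conj_stab, map_mul, map_mul, map_inv, h1, h2]
          exact ((hk l hl).mul_left htk).mul_left (hk l hl).inv_left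
        · rw [ret_of_not_mem hx]; simp
      | inv_of x h => 
        rw [map_inv, map_inv, map_inv]; exact h.inv_left
      | mul a b ha hb =>
        rw [map_mul, map_mul, map_mul]; exact ha.mul_left hb
    rw [← SemidirectProduct.inl_left_mul_inr_right m, map_mul, h1, ← hm2]
    exact (hf _).mul_left (hk _ hm1)
  obtain ⟨Θ, h3, h4⟩ := ce_lift θ1 k hM
  refine ⟨Θ, ?_, ?_, h4⟩
  · intro l
    rw [gL, MonoidHom.comp_apply, h3, h1]
  · rw [gt, h3, h2]

end Graph

section Pres
open scoped commutatorElement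
variable {E T : Type} [Fintype E] [Fintype T]
variable (α β : FreeGroup E →* FreeGroup T) {I : Type} (ι : E ⊕ T ⊕ Bool ≃ I)

def pa (e : E) : FreeGroup I := FreeGroup.of (ι (Sum.inl e))
def pb : FreeGroup T →* FreeGroup I := FreeGroup.map (fun s => ι (Sum.inr (Sum.inl s)))
def pt : FreeGroup I := FreeGroup.of (ι (Sum.inr (Sum.inr false)))
def pk : FreeGroup I := FreeGroup.of (ι (Sum.inr (Sum.inr true)))

open Classical in
noncomputable def prels : Finset (FreeGroup I) :=
  (Finset.univ.image fun x : E × T => ⁅pa ι x.1, pb ι (FreeGroup.of x.2)⁆) ∪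
  (Finset.univ.image fun e : E => ⁅pa ι e * pb ι (β (FreeGroup.of e)), pt ι⁆) ∪
  (Finset.univ.image fun e : E => ⁅pa ι e * pb ι (α (FreeGroup.of e)), pk ι⁆) ∪
  {⁅pt ι, pk ι⁆}

abbrev PG := PresentedGroup (prels α β ι : Set (FreeGroup I))

abbrev pmk : FreeGroup I →* PG α β ι := PresentedGroup.mk _

theorem rel1 (e : E) (s : T) :
    Commute (pmk α β ι (pa ι e)) (pmk α β ι (pb ι (FreeGroup.of s))) := by
  rw [← commutatorElement_eq_one_iff_commute, ← map_commutatorElement]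
  apply PresentedGroup.one_of_mem
  simp [prels]

theorem rel2 (e : E) :
    Commute (pmk α β ι (pa ι e) * pmk α β ι (pb ι (β (FreeGroup.of e)))) (pmk α β ι (pt ι)) := by
  rw [← commutatorElement_eq_one_iff_commute, ← map_mul, ← map_commutatorElement]
  apply PresentedGroup.one_of_mem
  simp [prels]

theorem rel3 (e : E) :
    Commute (pmk α β ι (pa ι e) * pmk α β ι (pb ι (α (FreeGroup.of e)))) (pmk α β ι (pk ι)) := by
  rw [← commutatorElement_eq_one_iff_commute, ← map_mul, ← map_commutatorElement]
  apply PresentedGroup.one_of_mem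
  simp [prels]

theorem rel4 : Commute (pmk α β ι (pt ι)) (pmk α β ι (pk ι)) := by
  rw [← commutatorElement_eq_one_iff_commute, ← map_commutatorElement]
  apply PresentedGroup.one_of_mem
  simp [prels]

theorem exists_hom : ∃ Φ : PG α β ι →* Gam α β,
    (∀ e, Φ (pmk α β ι (pa ι e)) = gL α β (FreeGroup.of e, 1)) ∧
    (∀ w, Φ (pmk α β ι (pb ι w)) = gL α β (1, w)) ∧
    Φ (pmk α β ι (pt ι)) = gt α β ∧ Φ (pmk α β ι (pk ι)) = gk α β := by
  let g : E ⊕ T ⊕ Bool → Gam α β := Sum.elim (fun e => gL α β (FreeGroup.of e, 1))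
    (Sum.elim (fun s => gL α β (1, FreeGroup.of s)) (fun b => if b then gk α β else gt α β))
  let F : FreeGroup I →* Gam α β := FreeGroup.lift (fun i => g (ι.symm i))
  have Fa : ∀ e, F (pa ι e) = gL α β (FreeGroup.of e, 1) := by
    intro e; simp [F, pa, g]
  have Fb : ∀ w, F (pb ι w) = gL α β (1, w) := by
    have : F.comp (pb ι) = (gL α β).comp (MonoidHom.inr _ _) := by
      ext s : 1; simp [F, pb, g]
    intro w
    exact DFunLike.congr_fun this w
  have Ft : F (pt ι) = gt α β := by simp [F, pt, g]
  have Fk : F (pk ι) = gk α β := by simp [F, pk, g]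
  have hr : ∀ r ∈ (prels α β ι : Set (FreeGroup I)), F r = 1 := by
    intro r hr
    simp only [prels, Finset.coe_union, Finset.coe_image, Set.mem_union,
      Set.mem_image, Finset.coe_singleton, Set.mem_singleton_iff] at hr
    rcases hr with ((⟨⟨e, s⟩, -, rfl⟩ | ⟨e, -, rfl⟩) | ⟨e, -, rfl⟩) | rfl
    · rw [map_commutatorElement, Fa, Fb, commutatorElement_eq_one_iff_commute]
      apply Commute.map
      simp [Commute, SemiconjBy]
    · rw [map_commutatorElement, map_mul, Fa, Fb, Ft, commutatorElement_eq_one_iff_commute,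
        ← map_mul]
      apply gt_commute
      simp [mem_gr]
    · rw [map_commutatorElement, map_mul, Fa, Fb, Fk, commutatorElement_eq_one_iff_commute,
        ← map_mul]
      apply gk_commute
      simp [mem_gr]
    · rw [map_commutatorElement, Ft, Fk, commutatorElement_eq_one_iff_commute]
      exact gk_gt_commute α β
  exact ⟨PresentedGroup.toGroup hr, Fa, Fb, Ft, Fk⟩

theorem exists_back : ∃ Θ : Gam α β →* PG α β ι,
    (∀ e, Θ (gL α β (FreeGroup.of e, 1)) = pmk α β ι (pa ι e)) ∧
    (∀ w, Θ (gL α β (1, w)) = pmk α β ι (pb ι w)) ∧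
    Θ (gt α β) = pmk α β ι (pt ι) ∧ Θ (gk α β) = pmk α β ι (pk ι) := by
  let f : FreeGroup E →* PG α β ι := FreeGroup.lift fun e => pmk α β ι (pa ι e)
  let g : FreeGroup T →* PG α β ι := (pmk α β ι).comp (pb ι)
  have hfe : ∀ e, f (FreeGroup.of e) = pmk α β ι (pa ι e) := by intro e; simp [f]
  have comm : ∀ u w, Commute (f u) (g w) := by
    intro u w
    induction u using FreeGroup.induction_on with
    | C1 => simp
    | of e =>
      rw [hfe]
      induction w using FreeGroup.induction_on with
      | C1 => simp
      | of s => exact rel1 α β ι e s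
      | inv_of s h => rw [map_inv]; exact h.inv_right
      | mul a b ha hb => rw [map_mul]; exact ha.mul_right hb
    | inv_of s h => rw [map_inv]; exact h.inv_left
    | mul a b ha hb => rw [map_mul]; exact ha.mul_left hb
  let θ : FreeGroup E × FreeGroup T →* PG α β ι := f.noncommCoprod g comm
  have hθ : ∀ u w, θ (u, w) = f u * g w := fun u w => MonoidHom.noncommCoprod_apply _ _ _ _
  have key : ∀ (φ : FreeGroup E →* FreeGroup T) (x : PG α β ι),
      (∀ e, Commute (pmk α β ι (pa ι e) * pmk α β ι (pb ι (φ (FreeGroup.of e)))) x) →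
      ∀ l ∈ gr φ, Commute (θ l) x := by
    rintro φ x hx ⟨u, w⟩ hl
    rw [mem_gr] at hl
    simp only at hl
    subst hl
    let θ' : FreeGroup E →* PG α β ι := θ.comp ((MonoidHom.id _).prod φ)
    change Commute (θ' u) x
    induction u using FreeGroup.induction_on with
    | C1 => simp
    | of e =>
      have : θ' (FreeGroup.of e) = pmk α β ι (pa ι e) * pmk α β ι (pb ι (φ (FreeGroup.of e))) := by
        rw [← hfe]; exact hθ _ _
      rw [this]; exact hx e
    | inv_of s h => rw [map_inv]; exact h.inv_left
    | mul a b ha hb => rw [map_mul]; exact ha.mul_left hb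
  obtain ⟨Θ, h1, h2, h3⟩ := gam_lift α β θ _ _ (key β _ (rel2 α β ι)) (key α _ (rel3 α β ι))
    (rel4 α β ι)
  refine ⟨Θ, fun e => ?_, fun w => ?_, h2, h3⟩
  · rw [h1, hθ, hfe, map_one, mul_one]
  · rw [h1, hθ, map_one, one_mul]; rfl

theorem pres_main : BiOrd (PG α β ι) ∧ ∀ w : FreeGroup T,
    ⁅pmk α β ι (pk ι), pmk α β ι (pb ι w * pt ι * (pb ι w)⁻¹)⁆ = 1 ↔ ∃ u, w = α u * (β u)⁻¹ := by
  obtain ⟨Φ, a1, a2, a3, a4⟩ := exists_hom α β ι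
  obtain ⟨Θ, b1, b2, b3, b4⟩ := exists_back α β ι
  have hid : Θ.comp Φ = MonoidHom.id _ := by
    apply PresentedGroup.ext
    intro i
    obtain ⟨d, rfl⟩ := ι.surjective i
    rcases d with e | s | b
    · exact (congrArg Θ (a1 e)).trans (b1 e)
    · exact (congrArg Θ (a2 (FreeGroup.of s))).trans (b2 _)
    · cases b
      · exact (congrArg Θ a3).trans b3
      · exact (congrArg Θ a4).trans b4
  have hinj : Function.Injective Φ := by
    intro x y hxy
    have h1 := DFunLike.congr_fun hid x
    have h2 := DFunLike.congr_fun hid y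
    simp only [MonoidHom.comp_apply, MonoidHom.id_apply] at h1 h2
    rw [← h1, ← h2, hxy]
  refine ⟨BiOrd.of_injective Φ hinj (biOrd_gam α β (biOrd_freeGroup _) (biOrd_freeGroup _)), ?_⟩
  intro w
  rw [← key_commute, ← map_eq_one_iff Φ hinj, map_commutatorElement, 
    commutatorElement_eq_one_iff_commute, Commute.symm_iff]
  simp only [map_mul, map_inv, a2, a3, a4]

end Pres
end OrdWP

namespace OrdWP
section Core
open scoped commutatorElement

theorem computable_replicate {τ : Type} [Primcodable τ] (a : τ) {N : ℕ → ℕ} (hN : Computable N) :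
    Computable fun n => List.replicate (N n) a := by
  have h : Primrec fun n : ℕ => (List.range n).map (fun _ => a) :=
    Primrec.list_map Primrec.list_range (Primrec.const a).to₂
  refine (h.to_comp.comp hN).of_eq fun n => ?_
  simp

theorem wordEval_eq {k : ℕ} {G : Type*} [Group G] (gen : Fin k → G) (w : List (Fin k × Bool)) :
    wordEval gen w = FreeGroup.lift gen (FreeGroup.mk w) := by
  rw [FreeGroup.lift_mk, wordEval]
  congr 2
  ext ⟨a, b⟩
  cases b <;> simp

theorem core {E T : Type} [Fintype E] [Fintype T] (α β : FreeGroup E →* FreeGroup T)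
    (c : T) (v : FreeGroup T) (N : ℕ → ℕ) (hN : Computable N)
    (hp : ¬ ComputablePred fun n => ∃ u, FreeGroup.of c ^ N n * v = α u * (β u)⁻¹) :
    ∃ (k : ℕ) (rels : Finset (FreeGroup (Fin k))),
      (∃ lt : PresentedGroup (rels : Set (FreeGroup (Fin k))) →
          PresentedGroup (rels : Set (FreeGroup (Fin k))) → Prop,
        IsStrictTotalOrder _ lt ∧
        ∀ f g h x, lt f g → lt (h * f * x) (h * g * x)) ∧
      ¬ ComputablePred fun w : List (Fin k × Bool) =>
          wordEval (fun i =>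
            (PresentedGroup.of i : PresentedGroup (rels : Set (FreeGroup (Fin k))))) w
            = 1 := by
  classical
  let ι := Fintype.equivFin (E ⊕ T ⊕ Bool)
  obtain ⟨⟨P, hP⟩, hw⟩ := pres_main α β ι
  refine ⟨_, prels α β ι, hP.lt, fun hc => hp ?_⟩
  let W : ℕ → List (Fin (Fintype.card (E ⊕ T ⊕ Bool)) × Bool) := fun n =>
    List.replicate (N n) (ι (Sum.inr (Sum.inl c)), true)
  have hW : ∀ n, FreeGroup.mk (W n) = pb ι (FreeGroup.of c ^ N n) := by
    intro n
    simp only [W]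
    rw [map_pow]
    induction N n with
    | zero => simp [FreeGroup.one_eq_mk]
    | succ m ih =>
      rw [List.replicate_succ, pow_succ', ← ih]
      rfl
  let W' : ℕ → List (Fin (Fintype.card (E ⊕ T ⊕ Bool)) × Bool) := fun n =>
    List.replicate (N n) (ι (Sum.inr (Sum.inl c)), false)
  have hW' : ∀ n, FreeGroup.mk (W' n) = (pb ι (FreeGroup.of c ^ N n))⁻¹ := by
    intro n
    rw [← hW, FreeGroup.inv_mk]
    simp [W, W', FreeGroup.invRev]
  have cW : Computable W := computable_replicate _ hN
  have cW' : Computable W' := computable_replicate _ hN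
  let tail : FreeGroup (Fin (Fintype.card (E ⊕ T ⊕ Bool))) := pb ι v * pt ι * (pb ι v)⁻¹
  let F : ℕ → List (Fin (Fintype.card (E ⊕ T ⊕ Bool)) × Bool) := fun n =>
    (pk ι).toWord ++ (W n ++ (tail.toWord ++ (W' n ++ ((pk ι)⁻¹.toWord ++
      (W n ++ (tail⁻¹.toWord ++ W' n))))))
  have cF : Computable F := by
    refine Computable.list_append.comp (Computable.const _) ?_
    refine Computable.list_append.comp cW ?_
    refine Computable.list_append.comp (Computable.const _) ?_
    refine Computable.list_append.comp cW' ?_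
    refine Computable.list_append.comp (Computable.const _) ?_
    refine Computable.list_append.comp cW ?_
    exact Computable.list_append.comp (Computable.const _) cW'
  have hF : ∀ n, FreeGroup.mk (F n) = ⁅pk ι, pb ι (FreeGroup.of c ^ N n * v) * pt ι *
      (pb ι (FreeGroup.of c ^ N n * v))⁻¹⁆ := by
    intro n
    simp only [F, ← FreeGroup.mul_mk, FreeGroup.mk_toWord, hW, hW', commutatorElement_def, tail]
    simp [mul_assoc]
  have hlift : ∀ x, FreeGroup.lift (fun i =>
      (PresentedGroup.of i : PG α β ι)) x = pmk α β ι x := by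
    have : FreeGroup.lift (fun i => (PresentedGroup.of i : PG α β ι)) = pmk α β ι := by
      ext i : 1
      rw [FreeGroup.lift_apply_of]; rfl
    intro x; rw [this]
  have h2 : ComputablePred fun n => wordEval (fun i =>
      (PresentedGroup.of i : PG α β ι)) (F n) = 1 :=
    ComputablePred.computable_of_manyOneReducible ⟨F, cF, fun n => Iff.rfl⟩ hc
  refine h2.of_eq fun n => ?_
  rw [wordEval_eq, hF, hlift, ← hw, map_commutatorElement]

end Core
end OrdWP

namespace OrdWP
section Queue
open StateTransition

/-- A reversible queue transducer. -/
structure QT (S T : Type) where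
  base : S
  step : S → T → Option (S × List T)
  inj : ∀ s s' x r y y', step s x = some (r, y) → step s' x = some (r, y') → s = s'
  wt : T → ℕ
  wt_le : ∀ s x r y, step s x = some (r, y) → (y.map wt).sum ≤ wt x
  dol : T
  dol_unread : ∀ s, step s dol = none
  wt_dol : 1 ≤ wt dol
  tau : S → List T

variable {S T : Type} (Q : QT S T)

/-- One step of the queue machine. -/
def QT.qstep : S × List T → Option (S × List T)
  | (_, []) => none
  | (s, x :: z) => (Q.step s x).map fun r => (r.1, z ++ r.2)

/-- A positive word. -/
def pl (z : List T) : List (T × Bool) := z.map fun x => (x, true)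

theorem pl_append (z w : List T) : pl (z ++ w) = pl z ++ pl w := by simp [pl]
@[simp] theorem pl_nil : pl ([] : List T) = [] := rfl
@[simp] theorem pl_cons (x : T) (z : List T) : pl (x :: z) = (x, true) :: pl z := rfl

inductive Path : S → List (T × Bool) → List (T × Bool) → S → Prop
  | nil (s : S) : Path s [] [] s
  | pos (s s1 s2 : S) (x : T) (y : List T) (L Y : List (T × Bool)) :
      Q.step s x = some (s1, y) → Path s1 L Y s2 → Path s ((x, true) :: L) (pl y ++ Y) s2
  | neg (s s1 s2 : S) (x : T) (y : List T) (L Y : List (T × Bool)) :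
      Q.step s1 x = some (s, y) → Path s1 L Y s2 →
        Path s ((x, false) :: L) (FreeGroup.invRev (pl y) ++ Y) s2

variable {Q}

theorem Path.append {s s1 s2 : S} {L Y L' Y' : List (T × Bool)} (h : Path Q s L Y s1)
    (h' : Path Q s1 L' Y' s2) : Path Q s (L ++ L') (Y ++ Y') s2 := by
  induction h with
  | nil s => exact h'
  | pos s s1 s2 x y L Y hs _ ih =>
    rw [List.append_assoc]; exact Path.pos _ _ _ _ _ _ _ hs (ih h')
  | neg s s1 s2 x y L Y hs _ ih =>
    rw [List.append_assoc]; exact Path.neg _ _ _ _ _ _ _ hs (ih h')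

theorem invRev_append (L L' : List (T × Bool)) :
    FreeGroup.invRev (L ++ L') = FreeGroup.invRev L' ++ FreeGroup.invRev L := by
  simp [FreeGroup.invRev]

theorem Path.inv {s s' : S} {L Y : List (T × Bool)} (h : Path Q s L Y s') :
    Path Q s' (FreeGroup.invRev L) (FreeGroup.invRev Y) s := by
  induction h with
  | nil s => exact Path.nil s
  | pos s s1 s2 x y L Y hs _ ih =>
    have h1 := ih.append (Path.neg s1 s s x y [] [] hs (Path.nil s))
    have e1 : FreeGroup.invRev ((x, true) :: L) = FreeGroup.invRev L ++ [(x, false)] := by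
      simp [FreeGroup.invRev]
    rw [e1, invRev_append]
    simpa using h1
  | neg s s1 s2 x y L Y hs _ ih =>
    have h1 := ih.append (Path.pos s1 s s x y [] [] hs (Path.nil s))
    have e1 : FreeGroup.invRev ((x, false) :: L) = FreeGroup.invRev L ++ [(x, true)] := by
      simp [FreeGroup.invRev]
    rw [e1, invRev_append, FreeGroup.invRev_invRev]
    simpa using h1

theorem Path.split {s s2 : S} {L L' Y : List (T × Bool)} (h : Path Q s (L ++ L') Y s2) :
    ∃ s1 Y1 Y2, Path Q s L Y1 s1 ∧ Path Q s1 L' Y2 s2 ∧ Y = Y1 ++ Y2 := by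
  induction L generalizing s Y with
  | nil => exact ⟨s, [], Y, Path.nil s, h, rfl⟩
  | cons a L ih =>
    rw [List.cons_append] at h
    cases h with
    | pos _ s1 _ x y _ Y hs h =>
      obtain ⟨r, Y1, Y2, h1, h2, rfl⟩ := ih h
      exact ⟨r, _, Y2, Path.pos _ _ _ _ _ _ _ hs h1, h2, by simp⟩
    | neg _ s1 _ x y _ Y hs h =>
      obtain ⟨r, Y1, Y2, h1, h2, rfl⟩ := ih h
      exact ⟨r, _, Y2, Path.neg _ _ _ _ _ _ _ hs h1, h2, by simp⟩

theorem Path.redStep {s s' : S} {L L' Y : List (T × Bool)} (h : Path Q s L Y s')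
    (hr : FreeGroup.Red.Step L L') :
    ∃ Y', Path Q s L' Y' s' ∧ FreeGroup.mk Y' = FreeGroup.mk Y := by
  cases hr with
  | @not L1 L2 x b =>
    obtain ⟨s1, Y1, Y2, h1, h2, rfl⟩ := h.split
    suffices h3 : ∃ Y3, Path Q s1 L2 Y3 s' ∧ FreeGroup.mk Y3 = FreeGroup.mk Y2 by
      obtain ⟨Y3, h3, h4⟩ := h3
      exact ⟨_, h1.append h3, by rw [← FreeGroup.mul_mk, h4, FreeGroup.mul_mk]⟩
    cases h2 with
    | pos _ r _ x y _ Y hs h =>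
      cases h with
      | neg _ r' _ x y' _ Y' hs' h3 =>
        have := Q.inj _ _ _ _ _ _ hs hs'
        subst this
        rw [hs] at hs'
        simp only [Option.some.injEq, Prod.mk.injEq, true_and] at hs'
        subst hs'
        refine ⟨Y', h3, ?_⟩
        simp [← FreeGroup.mul_mk, ← FreeGroup.inv_mk]
    | neg _ r _ x y _ Y hs h =>
      cases h with
      | pos _ r' _ x y' _ Y' hs' h3 =>
        rw [hs] at hs'
        simp only [Option.some.injEq, Prod.mk.injEq] at hs'
        obtain ⟨rfl, rfl⟩ := hs'
        refine ⟨Y', h3, ?_⟩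
        simp [← FreeGroup.mul_mk, ← FreeGroup.inv_mk]

theorem Path.red {s s' : S} {L L' Y : List (T × Bool)} (h : Path Q s L Y s')
    (hr : FreeGroup.Red L L') :
    ∃ Y', Path Q s L' Y' s' ∧ FreeGroup.mk Y' = FreeGroup.mk Y := by
  induction hr with
  | refl => exact ⟨Y, h, rfl⟩
  | tail _ hs ih =>
    obtain ⟨Y1, h1, h2⟩ := ih
    obtain ⟨Y2, h3, h4⟩ := h1.redStep hs
    exact ⟨Y2, h3, h4.trans h2⟩

/-- Total weight. -/
def QT.W (Q : QT S T) (L : List (T × Bool)) : ℕ := (L.map fun a => Q.wt a.1).sum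

theorem W_append (L L' : List (T × Bool)) : Q.W (L ++ L') = Q.W L + Q.W L' := by
  simp [QT.W]

theorem W_pl (z : List T) : Q.W (pl z) = (z.map Q.wt).sum := by
  simp [QT.W, pl, Function.comp_def]

theorem W_invRev (L : List (T × Bool)) : Q.W (FreeGroup.invRev L) = Q.W L := by
  simp [QT.W, FreeGroup.invRev, Function.comp_def, List.sum_reverse]

theorem Path.W_le {s s' : S} {L Y : List (T × Bool)} (h : Path Q s L Y s') : Q.W Y ≤ Q.W L := by
  induction h with
  | nil s => rfl
  | pos s s1 s2 x y L Y hs _ ih =>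
    have := Q.wt_le _ _ _ _ hs
    rw [W_append, W_pl]
    simp only [QT.W, List.map_cons, List.sum_cons] at *
    omega
  | neg s s1 s2 x y L Y hs _ ih =>
    have := Q.wt_le _ _ _ _ hs
    rw [W_append, W_invRev, W_pl]
    simp only [QT.W, List.map_cons, List.sum_cons] at *
    omega

theorem Path.no_dol {s s' : S} {L Y : List (T × Bool)} (h : Path Q s L Y s') :
    ∀ a ∈ L, a.1 ≠ Q.dol := by
  induction h with
  | nil s => simp
  | pos s s1 s2 x y L Y hs _ ih =>
    intro a ha
    rcases List.mem_cons.mp ha with rfl | ha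
    · rintro h
      simp only at h
      rw [h, Q.dol_unread] at hs
      simp at hs
    · exact ih a ha
  | neg s s1 s2 x y L Y hs _ ih =>
    intro a ha
    rcases List.mem_cons.mp ha with rfl | ha
    · rintro h
      simp only at h
      rw [h, Q.dol_unread] at hs
      simp at hs
    · exact ih a ha

theorem isReduced_pl (z : List T) : FreeGroup.IsReduced (pl z) := by
  unfold FreeGroup.IsReduced
  induction z with
  | nil => simp
  | cons x z ih =>
    cases z with
    | nil => simp
    | cons y z => 
      rw [pl_cons, pl_cons, List.isChain_cons_cons]
      exact ⟨fun _ => rfl, ih⟩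

theorem red_of_mk_eq {L R : List (T × Bool)} (hR : FreeGroup.IsReduced R)
    (h : FreeGroup.mk L = FreeGroup.mk R) : FreeGroup.Red L R := by
  classical
  have h1 : FreeGroup.reduce L = FreeGroup.reduce R := FreeGroup.reduce.sound h
  rw [FreeGroup.IsReduced.reduce_eq hR] at h1
  rw [← h1]
  exact FreeGroup.reduce.red

theorem isReduced_invRev {L : List (T × Bool)} (h : FreeGroup.IsReduced L) :
    FreeGroup.IsReduced (FreeGroup.invRev L) := by
  rw [FreeGroup.isReduced_iff_not_step] at h ⊢
  intro L2 h2
  have := h2.invRev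
  rw [FreeGroup.invRev_invRev] at this
  exact h _ this

theorem path_contra {s s' : S} {L Y : List (T × Bool)} (hL : FreeGroup.IsReduced L)
    (h : Path Q s L Y s') (a : T × Bool) (ha : L.head? = some a) (z : List T)
    (hz : ∀ x, z.head? = some x → a ≠ (x, true))
    (heq : FreeGroup.mk (pl z) * FreeGroup.mk Y = FreeGroup.mk L * FreeGroup.of Q.dol) : False := by
  have hR : FreeGroup.IsReduced (FreeGroup.invRev (pl z) ++ (L ++ [(Q.dol, true)])) := by
    unfold FreeGroup.IsReduced at hL ⊢
    rw [List.isChain_append, List.isChain_append]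
    refine ⟨isReduced_invRev (isReduced_pl z), ⟨hL, by simp, ?_⟩, ?_⟩
    · intro b hb c hc hbc
      have := h.no_dol b (List.mem_of_getLast? hb)
      simp at hc
      rw [← hc] at hbc
      exact absurd hbc this
    · intro b hb c hc hbc
      have h1 : (L ++ [(Q.dol, true)]).head? = some a := by
        rw [List.head?_append, ha]; rfl
      rw [h1] at hc
      simp at hc
      subst hc
      cases z with
      | nil => simp at hb
      | cons x z =>
        simp [FreeGroup.invRev] at hb
        subst hb
        simp only at hbc
        have := hz x rfl
        subst hbc
        obtain ⟨a1, a2⟩ := a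
        cases a2
        · rfl
        · exact absurd rfl this
  have h1 : FreeGroup.mk Y = FreeGroup.mk (FreeGroup.invRev (pl z) ++ (L ++ [(Q.dol, true)])) := by
    rw [← FreeGroup.mul_mk, ← FreeGroup.mul_mk, ← FreeGroup.inv_mk, ← mul_right_inj (FreeGroup.mk (pl z)),
      heq, mul_inv_cancel_left]
    rfl
  have h2 := (FreeGroup.Red.sublist (red_of_mk_eq hR h1))
  have h3 : Q.W (FreeGroup.invRev (pl z) ++ (L ++ [(Q.dol, true)])) ≤ Q.W Y := by
    unfold QT.W
    exact List.Sublist.sum_le_sum (h2.map _) (by simp)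
  rw [W_append, W_append] at h3
  have h4 := h.W_le
  have h5 : Q.W [(Q.dol, true)] = Q.wt Q.dol := by simp [QT.W]
  have := Q.wt_dol
  omega

theorem mk_cons_true (x : T) (L : List (T × Bool)) :
    FreeGroup.mk ((x, true) :: L) = FreeGroup.of x * FreeGroup.mk L := rfl

theorem path_main {s s' : S} {L Y : List (T × Bool)} (h : Path Q s L Y s')
    (hL : FreeGroup.IsReduced L) (z : List T)
    (heq : FreeGroup.mk (pl z) * FreeGroup.mk Y = FreeGroup.mk L * FreeGroup.of Q.dol) :
    Reaches Q.qstep (s, z) (s', [Q.dol]) := by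
  induction h generalizing z with
  | nil s =>
    have h1 : FreeGroup.mk (pl z) = FreeGroup.mk (pl [Q.dol]) := by
      rw [← FreeGroup.one_eq_mk, mul_one, one_mul] at heq
      exact heq
    have h2 := red_of_mk_eq (isReduced_pl _) h1
    have h3 := (FreeGroup.Red.sublist h2)
    have h4 := (FreeGroup.Red.sublist (red_of_mk_eq (isReduced_pl _) h1.symm))
    have h5 := h4.antisymm h3
    have h6 : z = [Q.dol] := by
      have := congrArg (List.map Prod.fst) h5
      simpa [pl, Function.comp_def] using this
    rw [h6]
    exact Relation.ReflTransGen.refl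
  | pos s s1 s2 x y L Y hs h ih =>
    by_cases hz : z.head? = some x
    · obtain ⟨z', rfl⟩ : ∃ z', z = x :: z' := by
        cases z with
        | nil => simp at hz
        | cons a z => simp at hz; exact ⟨z, by rw [hz]⟩
      have hL' : FreeGroup.IsReduced L := by
        unfold FreeGroup.IsReduced at hL ⊢
        exact hL.tail
      have h1 := ih hL' (z' ++ y) (by
        rw [pl_cons, mk_cons_true, mk_cons_true, mul_assoc, mul_assoc, mul_right_inj] at heq
        rw [← heq, pl_append, ← FreeGroup.mul_mk, ← FreeGroup.mul_mk, mul_assoc])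
      refine Relation.ReflTransGen.head ?_ h1
      simp [QT.qstep, hs]
    · exact (path_contra hL (Path.pos _ _ _ _ _ _ _ hs h) (x, true) rfl z (by
        intro a ha hx
        simp at hx
        rw [hx] at hz; exact hz ha) heq).elim
  | neg s s1 s2 x y L Y hs h ih =>
    exact (path_contra hL (Path.neg _ _ _ _ _ _ _ hs h) (x, false) rfl z (by simp) heq).elim

variable (Q)

def tauG (s : S) : FreeGroup T := FreeGroup.mk (pl (Q.tau s))

def alG : FreeGroup (S × T) →* FreeGroup T := FreeGroup.lift fun e =>
  match Q.step e.1 e.2 with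
  | none => 1
  | some r => tauG Q e.1 * FreeGroup.of e.2 * (tauG Q r.1)⁻¹

def beG : FreeGroup (S × T) →* FreeGroup T := FreeGroup.lift fun e =>
  match Q.step e.1 e.2 with
  | none => 1
  | some r => FreeGroup.mk (pl r.2)

theorem alG_some {s r : S} {x : T} {y : List T} (h : Q.step s x = some (r, y)) :
    alG Q (FreeGroup.of (s, x)) = tauG Q s * FreeGroup.of x * (tauG Q r)⁻¹ := by
  simp [alG, h]

theorem beG_some {s r : S} {x : T} {y : List T} (h : Q.step s x = some (r, y)) :
    beG Q (FreeGroup.of (s, x)) = FreeGroup.mk (pl y) := by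
  simp [beG, h]

theorem alG_none {s : S} {x : T} (h : Q.step s x = none) : alG Q (FreeGroup.of (s, x)) = 1 := by
  simp [alG, h]

theorem beG_none {s : S} {x : T} (h : Q.step s x = none) : beG Q (FreeGroup.of (s, x)) = 1 := by
  simp [beG, h]

theorem exists_path (hτ : ∀ s, Path Q Q.base (pl (Q.tau s)) [] s) (u : FreeGroup (S × T)) :
    ∃ L Y, Path Q Q.base L Y Q.base ∧ FreeGroup.mk L = alG Q u ∧ FreeGroup.mk Y = beG Q u := by
  induction u using FreeGroup.induction_on with
  | C1 => exact ⟨[], [], Path.nil _, by rw [map_one]; rfl, by rw [map_one]; rfl⟩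
  | of e =>
    obtain ⟨s, x⟩ := e
    rcases hs : Q.step s x with _ | ⟨r, y⟩
    · rw [alG_none Q hs, beG_none Q hs]
      exact ⟨[], [], Path.nil _, by simp [FreeGroup.one_eq_mk], by simp [FreeGroup.one_eq_mk]⟩
    · rw [alG_some Q hs, beG_some Q hs]
      refine ⟨_, _, (hτ s).append (Path.pos _ _ _ _ _ _ _ hs (hτ r).inv), ?_, ?_⟩
      · rw [← FreeGroup.mul_mk, mk_cons_true, ← FreeGroup.inv_mk, mul_assoc]; rfl
      · simp [FreeGroup.invRev]
  | inv_of e h =>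
    obtain ⟨L, Y, h1, h2, h3⟩ := h
    exact ⟨_, _, h1.inv, by rw [← FreeGroup.inv_mk, h2, map_inv],
      by rw [← FreeGroup.inv_mk, h3, map_inv]⟩
  | mul a b ha hb =>
    obtain ⟨L, Y, h1, h2, h3⟩ := ha
    obtain ⟨L', Y', h1', h2', h3'⟩ := hb
    exact ⟨_, _, h1.append h1', by rw [← FreeGroup.mul_mk, h2, h2', map_mul],
      by rw [← FreeGroup.mul_mk, h3, h3', map_mul]⟩

theorem sol_of_reaches {c d : S × List T} (h : Reaches Q.qstep c d)
    (hd : ∃ u, tauG Q d.1 * FreeGroup.mk (pl d.2) * beG Q u = alG Q u * FreeGroup.of Q.dol) :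
    ∃ u, tauG Q c.1 * FreeGroup.mk (pl c.2) * beG Q u = alG Q u * FreeGroup.of Q.dol := by
  induction h using Relation.ReflTransGen.head_induction_on with
  | refl => exact hd
  | @head c c' hc _ ih =>
    obtain ⟨u, hu⟩ := ih
    obtain ⟨s, z⟩ := c
    cases z with
    | nil => simp [QT.qstep] at hc
    | cons x z =>
      simp only [QT.qstep, Option.mem_def, Option.map_eq_some_iff] at hc
      obtain ⟨⟨r, y⟩, hs, rfl⟩ := hc
      refine ⟨FreeGroup.of (s, x) * u, ?_⟩
      rw [map_mul, map_mul, alG_some Q hs, beG_some Q hs, pl_cons, mk_cons_true]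
      rw [pl_append, ← FreeGroup.mul_mk] at hu
      simp only [mul_assoc] at hu ⊢
      rw [← hu]
      simp

theorem queue_iff (hτ : ∀ s, Path Q Q.base (pl (Q.tau s)) [] s) (hb : Q.tau Q.base = [])
    (z : List T) :
    (∃ u, FreeGroup.mk (pl z) * beG Q u = alG Q u * FreeGroup.of Q.dol) ↔
      Reaches Q.qstep (Q.base, z) (Q.base, [Q.dol]) := by
  classical
  have hb' : tauG Q Q.base = 1 := by rw [tauG, hb]; rfl
  constructor
  · rintro ⟨u, hu⟩
    obtain ⟨L, Y, h1, h2, h3⟩ := exists_path Q hτ u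
    obtain ⟨Y', h4, h5⟩ := h1.red (FreeGroup.reduce.red (L := L))
    refine path_main h4 ?_ z ?_
    · rw [FreeGroup.isReduced_iff_reduce_eq, FreeGroup.reduce.idem]
    · rw [h5, h3, hu, ← h2]
      congr 1
      exact FreeGroup.reduce.self.symm
  · intro h
    have := sol_of_reaches Q h ⟨1, by simp [hb']; rfl⟩
    simpa [hb'] using this

theorem queue_core [Fintype S] [Fintype T] (hτ : ∀ s, Path Q Q.base (pl (Q.tau s)) [] s)
    (hb : Q.tau Q.base = []) (c : T) (v : List T) (N : ℕ → ℕ) (hN : Computable N)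
    (hp : ¬ ComputablePred fun n =>
      Reaches Q.qstep (Q.base, List.replicate (N n) c ++ v) (Q.base, [Q.dol])) :
    ∃ (k : ℕ) (rels : Finset (FreeGroup (Fin k))),
      (∃ lt : PresentedGroup (rels : Set (FreeGroup (Fin k))) →
          PresentedGroup (rels : Set (FreeGroup (Fin k))) → Prop,
        IsStrictTotalOrder _ lt ∧
        ∀ f g h x, lt f g → lt (h * f * x) (h * g * x)) ∧
      ¬ ComputablePred fun w : List (Fin k × Bool) =>
          wordEval (fun i =>
            (PresentedGroup.of i : PresentedGroup (rels : Set (FreeGroup (Fin k))))) w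
            = 1 := by
  refine core (alG Q) ((MulAut.conj (FreeGroup.of Q.dol)).toMonoidHom.comp (beG Q)) c
    (FreeGroup.mk (pl v) * (FreeGroup.of Q.dol)⁻¹) N hN fun h => hp (h.of_eq fun n => ?_)
  rw [← queue_iff Q hτ hb]
  have hr : FreeGroup.mk (pl (List.replicate (N n) c)) = FreeGroup.of c ^ N n := by
    induction N n with
    | zero => rfl
    | succ m ih => rw [List.replicate_succ, pow_succ', ← ih]; rfl
  rw [pl_append, ← FreeGroup.mul_mk, hr]
  refine exists_congr fun u => ?_
  simp only [MonoidHom.comp_apply, MulEquiv.coe_toMonoidHom, MulAut.conj_apply, mul_inv_rev, inv_inv,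
    ← mul_assoc]
  rw [mul_left_inj, eq_mul_inv_iff_mul_eq]

end Queue
end OrdWP

namespace OrdWP
section Counter
open StateTransition

inductive Ltr (p : ℕ) : Type
  | c (i : Fin 3) : Ltr p
  | d (i : Fin 3) : Ltr p
  | h : Ltr p
  | h' (r : Fin 3 → Fin p) : Ltr p
  | dol : Ltr p

noncomputable instance (p : ℕ) : Fintype (Ltr p) := by
  classical
  let f : Ltr p → Fin 3 ⊕ Fin 3 ⊕ (Fin 3 → Fin p) ⊕ Bool := fun x =>
    match x with
    | Ltr.c i => Sum.inl i
    | Ltr.d i => Sum.inr (Sum.inl i)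
    | Ltr.h' r => Sum.inr (Sum.inr (Sum.inl r))
    | Ltr.h => Sum.inr (Sum.inr (Sum.inr false))
    | Ltr.dol => Sum.inr (Sum.inr (Sum.inr true))
  refine Fintype.ofInjective f ?_
  intro x y hxy
  cases x <;> cases y <;> simp_all [f]

noncomputable instance (p : ℕ) : DecidableEq (Ltr p) := Classical.decEq _

/-- Rules of a residue machine. -/
abbrev Rule (p : ℕ) := (Fin 3 → Fin p) → Option ((Fin 3 → ℕ) × (Fin 3 → ℕ))

variable {p : ℕ} [NeZero p]

def resid (p : ℕ) [NeZero p] (n : Fin 3 → ℕ) : Fin 3 → Fin p := fun i => Fin.ofNat p (n i)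

/-- One step of a residue machine. -/
def cstep (R : Rule p) (n : Fin 3 → ℕ) : Option (Fin 3 → ℕ) :=
  (R (resid p n)).map fun x i => x.1 i * (n i / p) + x.2 i

def cword (p : ℕ) (n : Fin 3 → ℕ) : List (Ltr p) :=
  List.replicate (n 0) (Ltr.c 0) ++ (List.replicate (n 1) (Ltr.c 1) ++
    List.replicate (n 2) (Ltr.c 2))

def IsC (w : List (Ltr p)) : Prop := ∀ x ∈ w, ∃ i, x = Ltr.c i
def IsD (w : List (Ltr p)) : Prop := ∀ x ∈ w, ∃ i, x = Ltr.d i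

theorem isC_cword (n : Fin 3 → ℕ) : IsC (cword p n) := by
  intro x hx
  simp only [cword, List.mem_append, List.mem_replicate] at hx
  rcases hx with hx | hx | hx
  · exact ⟨_, hx.2⟩
  · exact ⟨_, hx.2⟩
  · exact ⟨_, hx.2⟩

theorem count_cword (n : Fin 3 → ℕ) (i : Fin 3) : (cword p n).count (Ltr.c i) = n i := by
  fin_cases i <;> simp [cword, List.count_replicate]

def mult (R : Rule p) (r : Fin 3 → Fin p) (i : Fin 3) : ℕ :=
  match R r with
  | none => 0
  | some x => x.1 i

def outw (R : Rule p) (r : Fin 3 → Fin p) : List (Ltr p) :=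
  match R r with
  | none => [Ltr.dol]
  | some x => cword p x.2 ++ [Ltr.h]

noncomputable def tstep (R : Rule p) (r : Fin 3 → Fin p) :
    Ltr p → Option ((Fin 3 → Fin p) × List (Ltr p))
  | Ltr.c i => some (Function.update r i (r i + 1), if (r i).val + 1 = p then [Ltr.d i] else [])
  | Ltr.d i => some (r, List.replicate (mult R r i) (Ltr.c i))
  | Ltr.h => some (r, [Ltr.h' r])
  | Ltr.h' r' => if r = r' then some (0, outw R r) else none
  | Ltr.dol => none

def lwt : Ltr p → ℕ
  | Ltr.c _ => 0
  | Ltr.d _ => 0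
  | Ltr.h => 1
  | Ltr.h' _ => 1
  | Ltr.dol => 1

theorem lwt_isC {w : List (Ltr p)} (hw : IsC w) : (w.map lwt).sum = 0 := by
  induction w with
  | nil => rfl
  | cons x w ih =>
    obtain ⟨i, rfl⟩ := hw x (by simp)
    simp [lwt, ih fun y hy => hw y (by simp [hy])]

noncomputable def cQT (R : Rule p) : QT (Fin 3 → Fin p) (Ltr p) where
  base := 0
  step := tstep R
  inj := by
    intro s s' x r y y' h1 h2
    cases x with
    | c i =>
      simp only [tstep, Option.some.injEq, Prod.mk.injEq] at h1 h2
      have h3 := h1.1.trans h2.1.symm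
      ext1 j
      have h4 := congrFun h3 j
      by_cases hj : j = i
      · subst hj
        simpa using h4
      · simpa [hj] using h4
    | d i =>
      simp only [tstep, Option.some.injEq, Prod.mk.injEq] at h1 h2
      exact h1.1.trans h2.1.symm
    | h =>
      simp only [tstep, Option.some.injEq, Prod.mk.injEq] at h1 h2
      exact h1.1.trans h2.1.symm
    | h' r' =>
      simp only [tstep, Option.ite_none_right_eq_some] at h1 h2
      exact h1.1.trans h2.1.symm
    | dol => simp [tstep] at h1
  wt := lwt
  wt_le := by
    intro s x r y h
    cases x with
    | c i =>
      simp only [tstep, Option.some.injEq, Prod.mk.injEq] at h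
      rw [← h.2]
      split_ifs <;> simp [lwt]
    | d i =>
      simp only [tstep, Option.some.injEq, Prod.mk.injEq] at h
      rw [← h.2]
      simp [lwt]
    | h =>
      simp only [tstep, Option.some.injEq, Prod.mk.injEq] at h
      rw [← h.2]
      simp [lwt]
    | h' r' =>
      simp only [tstep, Option.ite_none_right_eq_some, Option.some.injEq, Prod.mk.injEq] at h
      rw [← h.2.2, outw]
      split
      · simp [lwt]
      · simp [lwt_isC (isC_cword _), lwt]
    | dol => simp [tstep] at h
  dol := Ltr.dol
  dol_unread := fun _ => rfl
  wt_dol := by simp [lwt]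
  tau := fun r => cword p fun i => (r i).val

section Rd
variable {S T : Type} (Q : QT S T)

inductive Rd : S → List T → List T → S → Prop
  | nil (s : S) : Rd s [] [] s
  | cons (s s1 s2 : S) (x : T) (y w o : List T) :
      Q.step s x = some (s1, y) → Rd s1 w o s2 → Rd s (x :: w) (y ++ o) s2

variable {Q}

theorem Rd.path {s s' : S} {w o : List T} (h : Rd Q s w o s') : Path Q s (pl w) (pl o) s' := by
  induction h with
  | nil s => exact Path.nil s
  | cons s s1 s2 x y w o hs _ ih =>
    rw [pl_append, pl_cons]; exact Path.pos _ _ _ _ _ _ _ hs ih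

theorem Rd.reaches {s s' : S} {w o : List T} (h : Rd Q s w o s') (z : List T) :
    Reaches Q.qstep (s, w ++ z) (s', z ++ o) := by
  induction h generalizing z with
  | nil s => rw [List.nil_append, List.append_nil]; exact Relation.ReflTransGen.refl
  | cons s s1 s2 x y w o hs _ ih =>
    refine Relation.ReflTransGen.head (b := (s1, (w ++ z) ++ y)) ?_ ?_
    · simp [QT.qstep, hs]
    · have := ih (z ++ y)
      simp only [List.append_assoc] at this ⊢
      exact this

end Rd

theorem cpass (R : Rule p) (w : List (Ltr p)) (hw : IsC w) (s : Fin 3 → Fin p) :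
    ∃ o s', Rd (cQT R) s w o s' ∧ IsD o ∧
      ∀ i, (s i).val + w.count (Ltr.c i) = p * o.count (Ltr.d i) + (s' i).val := by
  induction w generalizing s with
  | nil => exact ⟨[], s, Rd.nil s, by simp [IsD], by simp⟩
  | cons x w ih =>
    obtain ⟨j, rfl⟩ := hw x (by simp)
    obtain ⟨o, s', h1, h2, h3⟩ := ih (fun y hy => hw y (by simp [hy]))
      (Function.update s j (s j + 1))
    refine ⟨_, s', Rd.cons _ _ _ _ _ _ _ rfl h1, ?_, ?_⟩
    · intro y hy
      rcases List.mem_append.mp hy with hy | hy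
      · split_ifs at hy
        · simp at hy; exact ⟨_, hy⟩
        · simp at hy
      · exact h2 y hy
    · intro i
      have h4 := h3 i
      rw [List.count_append]
      have hp : 0 < p := Nat.pos_of_neZero p
      by_cases hi : i = j
      · subst hi
        rw [Function.update_self] at h4
        have h5 : (s i + 1).val = if (s i).val + 1 = p then 0 else (s i).val + 1 := by
          rw [Fin.val_add_eq_ite]
          have := (s i).2
          rcases Nat.lt_or_ge 1 p with h1p | h1p
          · have e1 : ((1 : Fin p) : ℕ) = 1 := by
              rw [Fin.val_one']; exact Nat.mod_eq_of_lt h1p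
            rw [e1]
            split_ifs <;> omega
          · have e0 : p = 1 := by omega
            have e1 : ((1 : Fin p) : ℕ) = 0 := by
              rw [Fin.val_one', e0]
            rw [e1]
            split_ifs <;> omega
        rw [h5] at h4
        rw [List.count_cons_self]
        split_ifs at h4 ⊢ with h6
        · simp only [List.count_singleton_self, mul_add]; omega
        · simp only [List.count_nil]; rw [zero_add]; omega
      · rw [Function.update_of_ne hi] at h4
        have h5 : (Ltr.c j :: w).count (Ltr.c i) = w.count (Ltr.c i) := by
          rw [List.count_cons_of_ne]; simpa using fun h => hi h.symm
        have h6 : (if (s j).val + 1 = p then [(Ltr.d j : Ltr p)] else []).count (Ltr.d i) = 0 := by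
          split_ifs
          · rw [List.count_eq_zero]; simpa using hi
          · rfl
        rw [h5, h6, h4]; ring

theorem dpass (R : Rule p) (w : List (Ltr p)) (hw : IsD w) (r : Fin 3 → Fin p) :
    ∃ o, Rd (cQT R) r w o r ∧ IsC o ∧
      ∀ i, o.count (Ltr.c i) = mult R r i * w.count (Ltr.d i) := by
  induction w with
  | nil => exact ⟨[], Rd.nil _, by simp [IsC], by simp⟩
  | cons x w ih =>
    obtain ⟨j, rfl⟩ := hw x (by simp)
    obtain ⟨o, h1, h2, h3⟩ := ih (fun y hy => hw y (by simp [hy]))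
    refine ⟨_, Rd.cons _ _ _ _ _ _ _ rfl h1, ?_, ?_⟩
    · intro y hy
      rcases List.mem_append.mp hy with hy | hy
      · exact ⟨_, (List.mem_replicate.mp hy).2⟩
      · exact h2 y hy
    · intro i
      rw [List.count_append, h3, List.count_replicate, List.count_cons]
      by_cases hi : i = j
      · subst hi; simp; ring
      · simp [Ne.symm hi]

theorem isC_nil {w : List (Ltr p)} (hw : IsC w) (h : ∀ i, w.count (Ltr.c i) = 0) : w = [] := by
  cases w with
  | nil => rfl
  | cons x w =>
    obtain ⟨i, rfl⟩ := hw x (by simp)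
    have := h i
    simp at this

theorem isD_nil {w : List (Ltr p)} (hw : IsD w) (h : ∀ i, w.count (Ltr.d i) = 0) : w = [] := by
  cases w with
  | nil => rfl
  | cons x w =>
    obtain ⟨i, rfl⟩ := hw x (by simp)
    have := h i
    simp at this

theorem tau_path (R : Rule p) (r : Fin 3 → Fin p) :
    Path (cQT R) (cQT R).base (pl ((cQT R).tau r)) [] r := by
  obtain ⟨o, s', h1, h2, h3⟩ := cpass R (cword p fun i => (r i).val) (isC_cword _) 0
  have h4 : ∀ i, o.count (Ltr.d i) = 0 ∧ s' i = r i := by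
    intro i
    have h5 := h3 i
    rw [count_cword] at h5
    have h6 := (r i).2
    have h7 : ((0 : Fin 3 → Fin p) i).val = 0 := by simp
    rw [h7, zero_add] at h5
    have h8 : o.count (Ltr.d i) = 0 := by
      by_contra hne
      have : p * 1 ≤ p * o.count (Ltr.d i) := Nat.mul_le_mul_left p (by omega)
      omega
    refine ⟨h8, ?_⟩
    ext
    rw [h8] at h5; omega
  have h5 := isD_nil h2 fun i => (h4 i).1
  subst h5
  have h6 : s' = r := funext fun i => (h4 i).2
  subst h6
  exact h1.path

/-- Configurations of the queue machine encoding counter states. -/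
def QRel (p : ℕ) [NeZero p] : Option (Fin 3 → ℕ) → (Fin 3 → Fin p) × List (Ltr p) → Prop
  | none, x => x = (0, [Ltr.dol])
  | some n, x => ∃ w, IsC w ∧ (∀ i, w.count (Ltr.c i) = n i) ∧ x = (0, w ++ [Ltr.h])

theorem big_step (R : Rule p) (n : Fin 3 → ℕ) (w : List (Ltr p)) (hw : IsC w)
    (hn : ∀ i, w.count (Ltr.c i) = n i) :
    ∃ x, QRel p (cstep R n) x ∧ Reaches₁ (cQT R).qstep (0, w ++ [Ltr.h]) x := by
  obtain ⟨o, r, h1, h2, h3⟩ := cpass R w hw 0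
  obtain ⟨o2, h4, h5, h6⟩ := dpass R o h2 r
  have h7 : Reaches (cQT R).qstep (0, w ++ [Ltr.h]) (r, Ltr.h :: o) := h1.reaches [Ltr.h]
  have h8 : (cQT R).qstep (r, Ltr.h :: o) = some (r, o ++ [Ltr.h' r]) := by
    simp [QT.qstep, cQT, tstep]
  have h9 : Reaches (cQT R).qstep (r, o ++ [Ltr.h' r]) (r, Ltr.h' r :: o2) := h4.reaches [Ltr.h' r]
  have h10 : (cQT R).qstep (r, Ltr.h' r :: o2) = some (0, o2 ++ outw R r) := by
    simp [QT.qstep, cQT, tstep]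
  have hmod : ∀ i, n i / p = o.count (Ltr.d i) ∧ n i % p = (r i).val := by
    intro i
    have e := h3 i
    have h7 : ((0 : Fin 3 → Fin p) i).val = 0 := by simp
    rw [h7, zero_add, hn] at e
    have hr := (r i).2
    have hp : 0 < p := Nat.pos_of_neZero p
    rw [e]
    constructor
    · rw [Nat.mul_add_div hp, Nat.div_eq_of_lt hr, add_zero]
    · rw [Nat.mul_add_mod, Nat.mod_eq_of_lt hr]
  have hres : resid p n = r := by
    ext i
    simp only [resid, Fin.ofNat]
    exact (hmod i).2
  refine ⟨(0, o2 ++ outw R r), ?_, ?_⟩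
  · simp only [cstep, hres, outw]
    rcases hR : R r with _ | ⟨m, g⟩
    · have : o2 = [] := isC_nil h5 fun i => by rw [h6, mult, hR]; simp
      simp [QRel, this]
    · refine ⟨o2 ++ cword p g, ?_, ?_, by simp⟩
      · intro x hx
        rcases List.mem_append.mp hx with hx | hx
        · exact h5 x hx
        · exact isC_cword g x hx
      · intro i
        rw [List.count_append, count_cword, h6]
        change _ = m i * (n i / p) + g i
        rw [(hmod i).1, mult, hR]
  · have a1 : Reaches (cQT R).qstep (0, w ++ [Ltr.h]) (r, Ltr.h' r :: o2) :=
      (h7.tail h8).trans h9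
    exact Relation.TransGen.tail' a1 h10

/-- Adding a final state. -/
def estep {σ : Type*} (f : σ → Option σ) (o : Option σ) : Option (Option σ) := o.map f

theorem estep_reaches {σ : Type*} (f : σ → Option σ) (a : σ) :
    Reaches (estep f) (some a) none ↔ (eval f a).Dom := by
  constructor
  · intro h
    have key : ∀ o, Reaches (estep f) o none → ∀ a, o = some a → (eval f a).Dom := by
      intro o ho
      induction ho using Relation.ReflTransGen.head_induction_on with
      | refl => simp
      | @head c c' hc _ ih =>
        rintro a rfl
        simp only [estep, Option.map_some, Option.mem_def, Option.some.injEq] at hc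
        cases hfa : f a with
        | none => exact Part.dom_iff_mem.mpr ⟨a, mem_eval.mpr ⟨Relation.ReflTransGen.refl, hfa⟩⟩
        | some b =>
          rw [reaches_eval (b := b) (Relation.ReflTransGen.single hfa)]
          exact ih b (by rw [← hc, hfa])
    exact key _ h a rfl
  · intro h
    obtain ⟨b, hb⟩ := Part.dom_iff_mem.mp h
    obtain ⟨h1, h2⟩ := mem_eval.mp hb
    refine Relation.ReflTransGen.tail (b := some b) ?_ (by simp [estep, h2])
    exact Relation.ReflTransGen.lift some (fun x y hxy => by
      have hxy' : f x = some y := hxy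
      change (some x).map f = some (some y)
      rw [Option.map_some, hxy']) _ _ h1

theorem queue_respects (R : Rule p) : Respects (estep (cstep R)) (cQT R).qstep (QRel p) := by
  intro a x hx
  cases a with
  | none =>
    simp only [QRel] at hx
    subst hx
    rfl
  | some n =>
    obtain ⟨w, h1, h2, rfl⟩ := hx
    exact big_step R n w h1 h2

theorem queue_halts (R : Rule p) (n : Fin 3 → ℕ) (w : List (Ltr p)) (hw : IsC w)
    (hn : ∀ i, w.count (Ltr.c i) = n i) :
    Reaches (cQT R).qstep (0, w ++ [Ltr.h]) (0, [Ltr.dol]) ↔ (eval (cstep R) n).Dom := by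
  rw [← estep_reaches]
  have h0 : QRel p (some n) (0, w ++ [Ltr.h]) := ⟨w, hw, hn, rfl⟩
  constructor
  · intro h
    have h1 : ((0, [Ltr.dol]) : (Fin 3 → Fin p) × List (Ltr p)) ∈
        eval (cQT R).qstep (0, w ++ [Ltr.h]) := mem_eval.mpr ⟨h, rfl⟩
    obtain ⟨b, -, h2⟩ := tr_eval_rev (queue_respects R) h0 h1
    obtain ⟨h3, h4⟩ := mem_eval.mp h2
    cases b with
    | none => exact h3
    | some b => simp [estep] at h4
  · intro h
    have h1 : none ∈ eval (estep (cstep R)) (some n) := mem_eval.mpr ⟨h, rfl⟩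
    obtain ⟨b, h2, h3⟩ := tr_eval (queue_respects R) h0 h1
    simp only [QRel] at h2
    subst h2
    exact (mem_eval.mp h3).1

theorem counter_core (R : Rule p) (g0 : Fin 3 → ℕ) (N : ℕ → ℕ) (hN : Computable N)
    (hp : ¬ ComputablePred fun n =>
      (eval (cstep R) (fun i => (if i = 0 then N n else 0) + g0 i)).Dom) :
    ∃ (k : ℕ) (rels : Finset (FreeGroup (Fin k))),
      (∃ lt : PresentedGroup (rels : Set (FreeGroup (Fin k))) →
          PresentedGroup (rels : Set (FreeGroup (Fin k))) → Prop,
        IsStrictTotalOrder _ lt ∧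
        ∀ f g h x, lt f g → lt (h * f * x) (h * g * x)) ∧
      ¬ ComputablePred fun w : List (Fin k × Bool) =>
          wordEval (fun i =>
            (PresentedGroup.of i : PresentedGroup (rels : Set (FreeGroup (Fin k))))) w
            = 1 := by
  refine queue_core (cQT R) (tau_path R) ?_ (Ltr.c 0) (cword p g0 ++ [Ltr.h]) N hN
    fun h => hp (h.of_eq fun n => ?_)
  · simp [cQT, cword]
  · rw [← List.append_assoc]
    refine queue_halts R _ _ ?_ ?_
    · intro x hx
      rcases List.mem_append.mp hx with hx | hx
      · exact ⟨_, (List.mem_replicate.mp hx).2⟩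
      · exact isC_cword _ x hx
    · intro i
      rw [List.count_append, count_cword, List.count_replicate]
      by_cases hi : i = 0
      · subst hi; simp
      · have hi' : ¬ (0 : Fin 3) = i := fun h => hi h.symm
        simp [hi, hi']

end Counter
end OrdWP

namespace OrdWP
section TMSim
open StateTransition Turing

variable {Γ Λ : Type} [Inhabited Γ] [Inhabited Λ]

/-- Base `p` value of a list of symbols. -/
def encL (p : ℕ) (dg : Γ → ℕ) : List Γ → ℕ
  | [] => 0
  | a :: l => dg a + p * encL p dg l

theorem encL_append (p : ℕ) (dg : Γ → ℕ) (h0 : dg default = 0) (l : List Γ) (n : ℕ) :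
    encL p dg (l ++ List.replicate n default) = encL p dg l := by
  induction l with
  | nil =>
    induction n with
    | zero => rfl
    | succ n ih =>
      rw [List.nil_append] at ih
      rw [List.nil_append, List.replicate_succ]
      simp [encL, ih, h0]
  | cons a l ih => rw [List.cons_append, encL, ih, encL]

def encB (p : ℕ) (dg : Γ → ℕ) (h0 : dg default = 0) (l : ListBlank Γ) : ℕ :=
  l.liftOn (encL p dg) fun a b ⟨n, h⟩ => by rw [h, encL_append p dg h0]

theorem encB_mk (p : ℕ) (dg : Γ → ℕ) (h0 : dg default = 0) (l : List Γ) :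
    encB p dg h0 (ListBlank.mk l) = encL p dg l := rfl

theorem encB_cons (p : ℕ) (dg : Γ → ℕ) (h0 : dg default = 0) (a : Γ) (l : ListBlank Γ) :
    encB p dg h0 (ListBlank.cons a l) = dg a + p * encB p dg h0 l := by
  induction l using ListBlank.induction_on with
  | _ l => rw [ListBlank.cons_mk, encB_mk, encB_mk, encL]

theorem encB_ht (p : ℕ) (dg : Γ → ℕ) (h0 : dg default = 0) (l : ListBlank Γ) :
    encB p dg h0 l = dg l.head + p * encB p dg h0 l.tail := by
  rw [← encB_cons, ListBlank.cons_head_tail]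

/-- Effect of a Turing machine statement on counters. -/
def stmtRule (p : ℕ) (dg : Γ → ℕ) (a b : Γ) (q' : ℕ) : TM0.Stmt Γ → (Fin 3 → ℕ) × (Fin 3 → ℕ)
  | TM0.Stmt.write c => (![p, p, 0], ![dg c, dg b, q'])
  | TM0.Stmt.move Dir.right => (![1, p * p, 0], ![0, dg a + p * dg b, q'])
  | TM0.Stmt.move Dir.left => (![p * p, 1, 0], ![dg b + p * dg a, 0, q'])

open Classical in
noncomputable def tmRule (p : ℕ) (M : TM0.Machine Γ Λ) (S : Finset Λ) (dg : Γ → ℕ) (sg : Λ → ℕ) :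
    Rule p := fun r =>
  if h : ∃ x : Λ × Γ × Γ, x.1 ∈ S ∧ dg x.2.1 = r 0 ∧ dg x.2.2 = r 1 ∧ sg x.1 = r 2 then
    (M h.choose.1 h.choose.2.1).map fun y =>
      stmtRule p dg h.choose.2.1 h.choose.2.2 (sg y.1) y.2
  else none

theorem tmRule_eq (p : ℕ) (M : TM0.Machine Γ Λ) (S : Finset Λ) (dg : Γ → ℕ) (sg : Λ → ℕ)
    (hdg : Function.Injective dg) (hsg : Set.InjOn sg S) (r : Fin 3 → Fin p) (q : Λ) (a b : Γ)
    (hq : q ∈ S) (h0 : dg a = r 0) (h1 : dg b = r 1) (h2 : sg q = r 2) :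
    tmRule p M S dg sg r = (M q a).map fun y => stmtRule p dg a b (sg y.1) y.2 := by
  have h : ∃ x : Λ × Γ × Γ, x.1 ∈ S ∧ dg x.2.1 = r 0 ∧ dg x.2.2 = r 1 ∧ sg x.1 = r 2 :=
    ⟨(q, a, b), hq, h0, h1, h2⟩
  have hs := h.choose_spec
  have e0 : h.choose.2.1 = a := hdg (hs.2.1.trans h0.symm)
  have e1 : h.choose.2.2 = b := hdg (hs.2.2.1.trans h1.symm)
  have e2 : h.choose.1 = q := hsg hs.1 hq (hs.2.2.2.trans h2.symm)
  rw [tmRule, dif_pos h, e0, e1, e2]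

/-- Counter encoding of a configuration. -/
def tmCfg (p : ℕ) (dg : Γ → ℕ) (h0 : dg default = 0) (sg : Λ → ℕ) (c : TM0.Cfg Γ Λ) : Fin 3 → ℕ :=
  ![dg c.Tape.head + p * encB p dg h0 c.Tape.right, encB p dg h0 c.Tape.left, sg c.q]

theorem tm_respects (p : ℕ) [NeZero p] (M : TM0.Machine Γ Λ) (S : Finset Λ) (hS : TM0.Supports M S)
    (dg : Γ → ℕ) (sg : Λ → ℕ) (h0 : dg default = 0)
    (hdg : Function.Injective dg) (hsg : Set.InjOn sg S) (hd : ∀ a, dg a < p)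
    (hs : ∀ q, sg q < p) :
    Respects (TM0.step M) (cstep (tmRule p M S dg sg))
      fun c n => c.q ∈ S ∧ n = tmCfg p dg h0 sg c := by
  rintro c n ⟨hq, rfl⟩
  have hp : 0 < p := Nat.pos_of_neZero p
  have hstep : cstep (tmRule p M S dg sg) (tmCfg p dg h0 sg c) =
      (TM0.step M c).map (tmCfg p dg h0 sg) := by
    obtain ⟨q, ⟨a, L, R⟩⟩ := c
    have hL := encB_ht p dg h0 L
    rw [cstep, tmRule_eq p M S dg sg hdg hsg _ q a L.head hq]
    · simp only [TM0.step, Option.map_map]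
      congr 1
      ext1 ⟨q', st⟩
      have d0 : (dg a + p * encB p dg h0 R) / p = encB p dg h0 R := by
        rw [add_comm, Nat.mul_add_div hp, Nat.div_eq_of_lt (hd a), add_zero]
      have d1 : encB p dg h0 L / p = encB p dg h0 L.tail := by
        rw [hL, add_comm, Nat.mul_add_div hp, Nat.div_eq_of_lt (hd _), add_zero]
      ext i
      rcases st with (_ | _) | b
      · fin_cases i
        · simp [stmtRule, tmCfg, d0, Tape.move, encB_cons]; ring
        · simp [stmtRule, tmCfg, d1, Tape.move]
        · simp [stmtRule, tmCfg]
      · fin_cases i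
        · simp [stmtRule, tmCfg, d0, Tape.move, ← encB_ht]
        · simp [stmtRule, tmCfg, d1, Tape.move, encB_cons]; rw [hL]; ring
        · simp [stmtRule, tmCfg]
      · fin_cases i
        · simp [stmtRule, tmCfg, d0, Tape.write]; ring
        · simp [stmtRule, tmCfg, d1, Tape.write]; rw [hL]; ring
        · simp [stmtRule, tmCfg]
    · simp [resid, tmCfg, Fin.ofNat, Nat.mod_eq_of_lt (hd a)]
    · simp [resid, tmCfg, Fin.ofNat]
      rw [hL, Nat.add_mul_mod_self_left, Nat.mod_eq_of_lt (hd _)]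
    · simp [resid, tmCfg, Fin.ofNat, Nat.mod_eq_of_lt (hs q)]
  cases hc : TM0.step M c with
  | none => rw [hc] at hstep; exact hstep
  | some c' =>
    rw [hc] at hstep
    exact ⟨_, ⟨TM0.step_supports M hS hc hq, rfl⟩, Relation.TransGen.single hstep⟩

theorem tm_core [Finite Γ] (M : TM0.Machine Γ Λ) (S : Finset Λ) (hS : TM0.Supports M S)
    (inp : ℕ → List Γ)
    (hcomp : ∀ p (dg : Γ → ℕ), Computable fun n => encL p dg (inp n))
    (hund : ¬ ComputablePred fun n => (TM0.eval M (inp n)).Dom) :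
    ∃ (k : ℕ) (rels : Finset (FreeGroup (Fin k))),
      (∃ lt : PresentedGroup (rels : Set (FreeGroup (Fin k))) →
          PresentedGroup (rels : Set (FreeGroup (Fin k))) → Prop,
        IsStrictTotalOrder _ lt ∧
        ∀ f g h x, lt f g → lt (h * f * x) (h * g * x)) ∧
      ¬ ComputablePred fun w : List (Fin k × Bool) =>
          wordEval (fun i =>
            (PresentedGroup.of i : PresentedGroup (rels : Set (FreeGroup (Fin k))))) w
            = 1 := by
  classical
  obtain ⟨m, ⟨eΓ⟩⟩ := Finite.exists_equiv_fin Γ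
  have hm : 0 < m := (eΓ default).pos
  haveI : NeZero m := ⟨hm.ne'⟩
  let dg : Γ → ℕ := fun a => (Equiv.swap (eΓ default) 0 (eΓ a)).val
  have h0 : dg default = 0 := by simp [dg]
  have hdg : Function.Injective dg := by
    intro a b hab
    exact eΓ.injective ((Equiv.swap _ _).injective (Fin.val_injective hab))
  let sg : Λ → ℕ := fun q => if h : q ∈ S then (S.equivFin ⟨q, h⟩).val else 0
  have hsg : Set.InjOn sg S := by
    intro a ha b hb hab
    have ha' : a ∈ S := ha
    have hb' : b ∈ S := hb
    simp only [sg, dif_pos ha', dif_pos hb'] at hab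
    have := S.equivFin.injective (Fin.val_injective hab)
    exact congrArg Subtype.val this
  let p := m + S.card
  haveI : NeZero p := ⟨by simp only [p]; omega⟩
  have hd : ∀ a, dg a < p := fun a => by
    have := (Equiv.swap (eΓ default) 0 (eΓ a)).2
    simp only [dg, p]; omega
  have hs : ∀ q, sg q < p := fun q => by
    simp only [sg, p]
    split_ifs with h
    · have := (S.equivFin ⟨q, h⟩).2
      omega
    · omega
  refine counter_core (tmRule p M S dg sg) ![0, 0, sg default] (fun n => encL p dg (inp n))
    (hcomp p dg) fun h => hund (h.of_eq fun n => ?_)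
  have key := tr_eval_dom (tm_respects p M S hS dg sg h0 hdg hsg hd hs)
    (a₁ := TM0.init (inp n)) ⟨hS.1, rfl⟩
  have e : (fun i => (if i = 0 then encL p dg (inp n) else 0) + ![0, 0, sg default] i) =
      tmCfg p dg h0 sg (TM0.init (inp n) : TM0.Cfg Γ Λ) := by
    have e1 := encB_ht p dg h0 (ListBlank.mk (inp n))
    rw [encB_mk] at e1
    ext i
    fin_cases i
    · simp [tmCfg, TM0.init, Tape.mk₁, Tape.mk₂, Tape.mk', e1]
    · simp [tmCfg, TM0.init, Tape.mk₁, Tape.mk₂, Tape.mk']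
      rfl
    · simp [tmCfg, TM0.init]
  rw [e]
  exact key

end TMSim
end OrdWP

namespace OrdWP
section Universal
open StateTransition Turing Turing.PartrecToTM2

theorem num_two_pow (k : ℕ) : ∃ m : PosNum, ((2 ^ k : ℕ) : Num) = Num.pos m ∧
    trPosNum m = List.replicate k Γ'.bit0 ++ [Γ'.bit1] := by
  induction k with
  | zero => exact ⟨PosNum.one, by simp; rfl, rfl⟩
  | succ k ih =>
    obtain ⟨m, h1, h2⟩ := ih
    refine ⟨PosNum.bit0 m, ?_, ?_⟩
    · have e : ((2 ^ (k + 1) : ℕ) : Num) = Num.bit0 (((2 ^ k : ℕ) : Num)) := by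
        rw [← Num.bit0_of_bit0, pow_succ, mul_two, Nat.cast_add]
      rw [e, h1]; rfl
    · rw [trPosNum, h2, List.replicate_succ, List.cons_append]

theorem trList_two_pow (k : ℕ) :
    trList [2 ^ k] = List.replicate k Γ'.bit0 ++ [Γ'.bit1, Γ'.cons] := by
  obtain ⟨m, h1, h2⟩ := num_two_pow k
  rw [trList, trNat, h1, trNum, h2, trList]
  simp

theorem trInit_two_pow : ∃ A B C : TM2to1.Γ' K' fun _ => Γ', ∀ k,
    TM2to1.trInit (Γ := fun _ => Γ') K'.main (trList [2 ^ k]) = A :: B :: List.replicate k C := by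
  refine ⟨(true, Function.update (fun _ => none) K'.main (some Γ'.cons)),
    (false, Function.update (fun _ => none) K'.main (some Γ'.bit1)), (false, Function.update (fun _ => none) K'.main (some Γ'.bit0)), fun k => ?_⟩
  rw [trList_two_pow, TM2to1.trInit]
  have e : (List.replicate k Γ'.bit0 ++ [Γ'.bit1, Γ'.cons]).reverse =
      Γ'.cons :: Γ'.bit1 :: List.replicate k Γ'.bit0 := by simp
  rw [e]
  let g : Γ' → TM2to1.Γ' K' fun _ => Γ' :=
    fun a => (false, Function.update (fun _ => none) K'.main (some a))
  have e2 : List.map g (List.replicate k Γ'.bit0) = List.replicate k (g Γ'.bit0) :=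
    List.map_replicate
  exact congrArg (fun l => (true, (g Γ'.cons).2) :: g Γ'.bit1 :: l) e2

theorem encL_comp {Γ : Type} (p : ℕ) (dg : Γ → ℕ) (A B C : Γ) :
    Computable fun k => encL p dg (A :: B :: List.replicate k C) := by
  have h : Computable fun k : ℕ => encL p dg (List.replicate k C) := by
    have h1 : Primrec fun k : ℕ => (Nat.rec 0 (fun _ y => dg C + p * y) k : ℕ) :=
      Primrec.nat_rec₁ 0 (Primrec.nat_add.comp (Primrec.const _)
        (Primrec.nat_mul.comp (Primrec.const _) Primrec.snd))
    refine h1.to_comp.of_eq fun k => ?_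
    induction k with
    | zero => rfl
    | succ k ih => rw [List.replicate_succ, encL, ← ih]
  have h2 : Primrec fun y : ℕ => dg A + p * (dg B + p * y) :=
    Primrec.nat_add.comp (Primrec.const _) (Primrec.nat_mul.comp (Primrec.const _)
      (Primrec.nat_add.comp (Primrec.const _) (Primrec.nat_mul.comp (Primrec.const _) Primrec.id)))
  exact h2.to_comp.comp h

theorem two_pow_primrec : Primrec fun k : ℕ => 2 ^ k := by
  have h1 : Primrec fun k : ℕ => (Nat.rec 1 (fun _ y => y * 2) k : ℕ) :=
    Primrec.nat_rec₁ 1 (Primrec.nat_mul.comp Primrec.snd (Primrec.const 2))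
  refine h1.of_eq fun k => ?_
  induction k with
  | zero => rfl
  | succ k ih => rw [pow_succ, ← ih]

theorem exists_halting : ∃ c : ToPartrec.Code,
    ¬ ComputablePred fun k : ℕ => (c.eval [2 ^ k]).Dom := by
  let f : ℕ →. ℕ := fun m => (Nat.rfind fun k => Part.some (decide (2 ^ k = m))).bind fun k =>
    Nat.Partrec.Code.eval (Denumerable.ofNat Nat.Partrec.Code k) 0
  have hf : Partrec f := by
    refine Partrec.bind (Partrec.rfind ?_) ?_
    · have h : PrimrecRel fun (m k : ℕ) => 2 ^ k = m :=
        Primrec.eq.comp (two_pow_primrec.comp Primrec.snd) Primrec.fst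
      exact (PrimrecPred.decide h).to_comp.partrec
    · exact Nat.Partrec.Code.eval_part.comp
        ((Computable.ofNat _).comp Computable.snd) (Computable.const 0)
  obtain ⟨c, hc⟩ := ToPartrec.Code.exists_code (Nat.Partrec'.part_iff₁.mpr hf)
  refine ⟨c, fun h => ComputablePred.halting_problem 0 ?_⟩
  have hk : ∀ k, (c.eval [2 ^ k]).Dom ↔
      (Nat.Partrec.Code.eval (Denumerable.ofNat Nat.Partrec.Code k) 0).Dom := by
    intro k
    have h1 := hc ⟨[2 ^ k], rfl⟩
    have h2 : f (2 ^ k) = Nat.Partrec.Code.eval (Denumerable.ofNat Nat.Partrec.Code k) 0 := by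
      have : (Nat.rfind fun j => Part.some (decide (2 ^ j = 2 ^ k))) = Part.some k := by
        rw [Part.eq_some_iff]
        refine Nat.mem_rfind.mpr ?_
        constructor
        · simp
        · intro m hm
          have : ¬ (2 ^ m = 2 ^ k) := fun e => hm.ne (Nat.pow_right_injective le_rfl e)
          simp [this]
      simp only [f]
      rw [this, Part.bind_some]
    rw [← h2]
    change c.eval [2 ^ k] = pure <$> f (2 ^ k) at h1
    rw [h1]
    rfl
  refine ComputablePred.of_eq (ComputablePred.computable_of_manyOneReducible
    ⟨fun c : Nat.Partrec.Code => Encodable.encode c, Computable.encode, fun _ => Iff.rfl⟩ h)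
    fun c' => ?_
  rw [hk, Denumerable.ofNat_encode]

theorem tm2_init (c : ToPartrec.Code) (v : List ℕ) :
    (@TM2.init K' (fun _ => Γ') Λ' (Option Γ') ⟨trNormal c Cont'.halt⟩ _ _ K'.main (trList v)) =
      PartrecToTM2.init c v := by
  unfold TM2.init PartrecToTM2.init
  congr 1
  funext k
  cases k <;> rfl

instance finite_K' : Finite K' :=
  Finite.of_surjective (fun i : Fin 4 => ![K'.main, K'.rev, K'.aux, K'.stack] i) (by
    intro k
    cases k
    · exact ⟨0, rfl⟩
    · exact ⟨1, rfl⟩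
    · exact ⟨2, rfl⟩
    · exact ⟨3, rfl⟩)

instance finite_tape : Finite (TM2to1.Γ' K' fun _ => Γ') := by
  have := Fintype.ofFinite K'
  exact inferInstance

theorem main_result :
    ∃ (k : ℕ) (rels : Finset (FreeGroup (Fin k))),
      (∃ lt : PresentedGroup (rels : Set (FreeGroup (Fin k))) →
          PresentedGroup (rels : Set (FreeGroup (Fin k))) → Prop,
        IsStrictTotalOrder _ lt ∧
        ∀ f g h x, lt f g → lt (h * f * x) (h * g * x)) ∧
      ¬ ComputablePred fun w : List (Fin k × Bool) =>
          wordEval (fun i =>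
            (PresentedGroup.of i : PresentedGroup (rels : Set (FreeGroup (Fin k))))) w
            = 1 := by
  classical
  obtain ⟨c, hc⟩ := exists_halting
  obtain ⟨A, B, C, hABC⟩ := trInit_two_pow
  let _ : Inhabited Λ' := ⟨trNormal c Cont'.halt⟩
  have hS := TM1to0.tr_supports _ (TM2to1.tr_supports _ (PartrecToTM2.tr_supports c Cont'.halt))
  refine tm_core _ _ hS
    (fun k => TM2to1.trInit (Γ := fun _ => Γ') K'.main (trList [2 ^ k])) ?_ fun h =>
      hc (h.of_eq fun k => ?_)
  · intro p dg
    simp only [hABC]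
    exact encL_comp p dg A B C
  · rw [TM1to0.tr_eval]
    refine (TM2to1.tr_eval_dom (Γ := fun _ => Γ') PartrecToTM2.tr K'.main _).trans ?_
    have e : (StateTransition.eval (TM2.step PartrecToTM2.tr)
        (TM2.init (Γ := fun _ => Γ') (Λ := Λ') (σ := Option Γ') K'.main (trList [2 ^ k]))).Dom ↔
        (c.eval [2 ^ k]).Dom := by
      have e1 := tm2_init c [2 ^ k]
      have e2 := PartrecToTM2.tr_eval c [2 ^ k]
      rw [← e1] at e2
      exact (iff_of_eq (congrArg Part.Dom e2)).trans Iff.rfl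
    exact e

end Universal
end OrdWP

/-- There is a finitely presented, two-sided orderable group with insoluble word
problem. -/
theorem exists_fp_orderable_insoluble_wp :
    ∃ (k : ℕ) (rels : Finset (FreeGroup (Fin k))),
      (∃ lt : PresentedGroup (rels : Set (FreeGroup (Fin k))) →
          PresentedGroup (rels : Set (FreeGroup (Fin k))) → Prop,
        IsStrictTotalOrder _ lt ∧
        ∀ f g h x, lt f g → lt (h * f * x) (h * g * x)) ∧
      ¬ ComputablePred fun w : List (Fin k × Bool) =>
          wordEval (fun i =>
            (PresentedGroup.of i : PresentedGroup (rels : Set (FreeGroup (Fin k))))) w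
            = 1 := by
  exact OrdWP.main_result
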